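/- Let dv_n be the normalized Riemannian probability measure on the unit sphere S^n ⊂ R^{n+1}, with n ≥ 2. For g ∈ H¹₂(dv_n) and i = 1,…,n+1, let ∇_i g(θ) denote the i-th component in R^{n+1} of the Riemannian gradient ∇g(θ) ∈ T_θ S^n ⊂ R^{n+1}. Then Var(g) ≤ (1/(n−1)) Σ_{i=1}^{n+1} ‖∇_i g‖₂² · φ(‖∇_i g‖₁ / ‖∇_i g‖₂), with norms taken in L^p(dv_n). -/

import Mathlib

open MeasureTheory ProbabilityTheory Real Set Filter Metric
open scoped ENNReal Topology RealInnerProductSpace Gradient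

noncomputable section

/-- `φ(u) = 2∫₀¹ u^{2t}/(1+t)² dt`. -/
def phiBKS (u : ℝ) : ℝ := 2 * ∫ t in (0:ℝ)..1, u ^ (2*t) / (1+t)^2

/-- The normalized uniform (Riemannian volume) probability measure on the unit sphere
`S^n ⊂ ℝ^{n+1}`. -/
def sphereUniform (n : ℕ) : Measure (sphere (0 : EuclideanSpace ℝ (Fin (n+1))) 1) :=
  ((volume : Measure (EuclideanSpace ℝ (Fin (n+1)))).toSphere Set.univ)⁻¹ •
    (volume : Measure (EuclideanSpace ℝ (Fin (n+1)))).toSphere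

/-- The `i`-th component (in `ℝ^{n+1}`) of the spherical (tangential) gradient of `g`
at a point `x` of the unit sphere: the Euclidean gradient minus its radial part. -/
def sphereGradComp (n : ℕ) (g : EuclideanSpace ℝ (Fin (n+1)) → ℝ)
    (x : EuclideanSpace ℝ (Fin (n+1))) (i : Fin (n+1)) : ℝ :=
  (∇ g x - ⟪∇ g x, x⟫ • x) i

lemma tp_aux1 {s y : ℝ} (hs0 : 0 < s) (hs1 : s < 1) (hy0 : 0 ≤ y) (hy1 : y < 1) :
    2 * s * y ≤ (1 + y) ^ s - (1 - y) ^ s := by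
  have key : MonotoneOn (fun y : ℝ => (1 + y) ^ s - (1 - y) ^ s - 2 * s * y) (Set.Ico 0 1) := by
    have hd : ∀ x ∈ Set.Ico (0:ℝ) 1, HasDerivAt
        (fun y : ℝ => (1 + y) ^ s - (1 - y) ^ s - 2 * s * y)
        (s * (1 + x) ^ (s - 1) + s * (1 - x) ^ (s - 1) - 2 * s) x := by
      intro x hx
      have h1 : HasDerivAt (fun y : ℝ => (1 + y) ^ s) (1 * s * (1 + x) ^ (s - 1)) x :=
        ((hasDerivAt_id x).const_add 1).rpow_const (Or.inl (by have := hx.1; simp only [id]; linarith))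
      have h2 : HasDerivAt (fun y : ℝ => (1 - y) ^ s) (-1 * s * (1 - x) ^ (s - 1)) x :=
        ((hasDerivAt_id x).const_sub 1).rpow_const (Or.inl (by have := hx.2; simp only [id]; linarith))
      have h3 : HasDerivAt (fun y : ℝ => 2 * s * y) (2 * s * 1) x :=
        (hasDerivAt_id x).const_mul (2 * s)
      convert! (h1.sub h2).sub h3 using 1
      ring
    apply monotoneOn_of_deriv_nonneg (convex_Ico 0 1)
    · exact fun x hx => (hd x hx).continuousAt.continuousWithinAt
    · exact fun x hx => (hd x (interior_subset hx)).differentiableAt.differentiableWithinAt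
    · intro x hx
      have hx := interior_subset hx
      rw [(hd x hx).deriv]
      have hp1 : 0 < 1 + x := by linarith [hx.1]
      have hp2 : 0 < 1 - x := by linarith [hx.2]
      have e1 : 1 + x = Real.exp (Real.log (1 + x)) := (Real.exp_log hp1).symm
      have a1 : 1 + (s - 1) * Real.log (1 + x) ≤ (1 + x) ^ (s - 1) := by
        rw [Real.rpow_def_of_pos hp1]
        have := Real.add_one_le_exp (Real.log (1 + x) * (s - 1))
        linarith
      have a2 : 1 + (s - 1) * Real.log (1 - x) ≤ (1 - x) ^ (s - 1) := by
        rw [Real.rpow_def_of_pos hp2]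
        have := Real.add_one_le_exp (Real.log (1 - x) * (s - 1))
        linarith
      have a3 : Real.log (1 + x) + Real.log (1 - x) ≤ 0 := by
        rw [← Real.log_mul hp1.ne' hp2.ne']
        apply Real.log_nonpos <;> nlinarith [sq_nonneg x]
      have a4 : 0 ≤ (1 - s) * (-(Real.log (1 + x) + Real.log (1 - x))) :=
        mul_nonneg (by linarith) (by linarith)
      have : 0 ≤ s * ((1 + x) ^ (s - 1) + (1 - x) ^ (s - 1) - 2) :=
        mul_nonneg hs0.le (by nlinarith)
      linarith
  have := key (a := 0) (b := y) ⟨le_rfl, one_pos⟩ ⟨hy0, hy1⟩ hy0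
  simp at this
  linarith

lemma tp_aux2 {s y : ℝ} (hs0 : 0 < s) (hs1 : s < 1) (hy0 : 0 ≤ y) (hy1 : y ≤ 1) :
    1 + (1 + s) / 2 * (s * y ^ 2) ≤ ((1 + y) ^ (1 + s) + (1 - y) ^ (1 + s)) / 2 := by
  have key : MonotoneOn (fun y : ℝ => ((1 + y) ^ (1 + s) + (1 - y) ^ (1 + s)) / 2
      - (1 + s) / 2 * (s * y ^ 2)) (Set.Icc 0 1) := by
    have hd : ∀ x ∈ Set.Icc (0:ℝ) 1, HasDerivAt
        (fun y : ℝ => ((1 + y) ^ (1 + s) + (1 - y) ^ (1 + s)) / 2 - (1 + s) / 2 * (s * y ^ 2))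
        ((1 + s) / 2 * ((1 + x) ^ s - (1 - x) ^ s - 2 * s * x)) x := by
      intro x hx
      have h1 : HasDerivAt (fun y : ℝ => (1 + y) ^ (1 + s)) (1 * (1 + s) * (1 + x) ^ (1 + s - 1)) x :=
        ((hasDerivAt_id x).const_add 1).rpow_const (Or.inr (by linarith))
      have h2 : HasDerivAt (fun y : ℝ => (1 - y) ^ (1 + s)) (-1 * (1 + s) * (1 - x) ^ (1 + s - 1)) x :=
        ((hasDerivAt_id x).const_sub 1).rpow_const (Or.inr (by linarith))
      have h3 : HasDerivAt (fun y : ℝ => (1 + s) / 2 * (s * y ^ 2)) ((1 + s) / 2 * (s * (2 * x))) x := by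
        convert! ((hasDerivAt_pow 2 x).const_mul s).const_mul ((1 + s) / 2) using 1
        simp
      convert! ((h1.add h2).div_const 2).sub h3 using 1
      rw [show 1 + s - 1 = s by ring]
      ring
    apply monotoneOn_of_deriv_nonneg (convex_Icc 0 1)
    · exact fun x hx => (hd x hx).continuousAt.continuousWithinAt
    · exact fun x hx => (hd x (interior_subset hx)).differentiableAt.differentiableWithinAt
    · intro x hx
      rw [(hd x (interior_subset hx)).deriv]
      rw [interior_Icc] at hx
      have := tp_aux1 hs0 hs1 hx.1.le hx.2
      exact mul_nonneg (by linarith) (by linarith)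
  have := key (a := 0) (b := y) ⟨le_rfl, zero_le_one⟩ ⟨hy0, hy1⟩ hy0
  simp at this
  linarith

lemma tp_aux3 {s m d : ℝ} (hs0 : 0 < s) (hs1 : s < 1) (hd0 : 0 ≤ d) (hdm : d ≤ m) :
    (m ^ 2 + s * d ^ 2) ^ ((1 + s) / 2) ≤ ((m + d) ^ (1 + s) + (m - d) ^ (1 + s)) / 2 := by
  rcases eq_or_lt_of_le (hd0.trans hdm) with h | hm
  · have : d = 0 := by linarith
    subst this; rw [← h]
    have h1 : (1 + s) ≠ 0 := by linarith
    have h2 : (1 + s) / 2 ≠ 0 := by positivity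
    simp [Real.zero_rpow h1, Real.zero_rpow h2]
  set y := d / m with hy
  have hy0 : 0 ≤ y := by positivity
  have hy1 : y ≤ 1 := (div_le_one hm).2 hdm
  have hdy : d = m * y := by rw [hy]; field_simp
  have e1 : m ^ 2 + s * d ^ 2 = m ^ 2 * (1 + s * y ^ 2) := by rw [hdy]; ring
  have e2 : m + d = m * (1 + y) := by rw [hdy]; ring
  have e3 : m - d = m * (1 - y) := by rw [hdy]; ring
  rw [e1, e2, e3, Real.mul_rpow (by positivity) (by positivity),
    Real.mul_rpow hm.le (by linarith), Real.mul_rpow hm.le (by linarith)]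
  have e4 : (m ^ 2) ^ ((1 + s) / 2) = m ^ (1 + s) := by
    rw [← Real.rpow_natCast, ← Real.rpow_mul hm.le]; congr 1; push_cast; ring
  rw [e4, ← mul_add, mul_div_assoc]
  apply mul_le_mul_of_nonneg_left _ (by positivity)
  refine le_trans ?_ (tp_aux2 hs0 hs1 hy0 hy1)
  have := rpow_one_add_le_one_add_mul_self (s := s * y ^ 2) (p := (1 + s) / 2)
    (by nlinarith [sq_nonneg y]) (by positivity) (by linarith)
  linarith

lemma tp_aux4 {s a b : ℝ} (hs0 : 0 < s) (hs1 : s < 1) (ha : 0 ≤ a) (hb : 0 ≤ b) :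
    Real.sqrt (((a + b) / 2) ^ 2 + s * ((a - b) / 2) ^ 2) ≤
      ((a ^ (1 + s) + b ^ (1 + s)) / 2) ^ (1 / (1 + s)) := by
  wlog hab : b ≤ a generalizing a b
  · have := this hb ha (not_le.1 hab).le
    rw [add_comm a b, add_comm (a ^ (1 + s))]
    convert this using 4
    ring
  have h := tp_aux3 (m := (a + b) / 2) (d := (a - b) / 2) hs0 hs1 (by linarith) (by linarith)
  rw [show (a + b) / 2 + (a - b) / 2 = a by ring, show (a + b) / 2 - (a - b) / 2 = b by ring] at h
  have h2 := Real.rpow_le_rpow (by positivity) h (z := 1 / (1 + s)) (by positivity)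
  rw [← Real.rpow_mul (by positivity)] at h2
  rw [Real.sqrt_eq_rpow]
  convert h2 using 2
  field_simp

/-- two-point bilinear hypercontractivity -/
lemma two_point {s a b c d : ℝ} (hs0 : 0 < s) (hs1 : s < 1) (ha : 0 ≤ a) (hb : 0 ≤ b)
    (hc : 0 ≤ c) (hd : 0 ≤ d) :
    ((1 + s) * (a * c + b * d) + (1 - s) * (a * d + b * c)) / 4 ≤
      ((a ^ (1 + s) + b ^ (1 + s)) / 2) ^ (1 / (1 + s)) *
      ((c ^ (1 + s) + d ^ (1 + s)) / 2) ^ (1 / (1 + s)) := by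
  refine le_trans ?_ (mul_le_mul (tp_aux4 hs0 hs1 ha hb) (tp_aux4 hs0 hs1 hc hd)
    (by positivity) (by positivity))
  rw [← Real.sqrt_mul (by positivity)]
  apply Real.le_sqrt_of_sq_le
  nlinarith [mul_nonneg hs0.le (sq_nonneg (((a + b) / 2) * ((c - d) / 2) - ((a - b) / 2) * ((c + d) / 2)))]

/-- signs -/
def sg (b : Bool) : ℝ := if b then 1 else -1

@[simp] lemma sg_true : sg true = 1 := by simp [sg]
@[simp] lemma sg_false : sg false = -1 := by simp [sg]

lemma sg_not (b : Bool) : sg (!b) = - sg b := by cases b <;> simp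
lemma sg_mul_self (b : Bool) : sg b * sg b = 1 := by cases b <;> simp

/-- Expectation on the cube. -/
def Ex {ι : Type*} [Fintype ι] [DecidableEq ι] (F : (ι → Bool) → ℝ) : ℝ :=
  (2 ^ Fintype.card ι)⁻¹ * ∑ x, F x

/-- noise bilinear form -/
def KK {ι : Type*} [Fintype ι] [DecidableEq ι] (s : ℝ) (F G : (ι → Bool) → ℝ) : ℝ :=
  (4 ^ Fintype.card ι)⁻¹ * ∑ x, ∑ y, F x * G y * ∏ k, (1 + s * (sg (x k) * sg (y k)))

lemma Ex_nonneg {ι : Type*} [Fintype ι] [DecidableEq ι] {F : (ι → Bool) → ℝ} (hF : ∀ x, 0 ≤ F x) :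
    0 ≤ Ex F := mul_nonneg (by positivity) (Finset.sum_nonneg fun x _ => hF x)

lemma Ex_mono {ι : Type*} [Fintype ι] [DecidableEq ι] {F G : (ι → Bool) → ℝ} (h : ∀ x, F x ≤ G x) :
    Ex F ≤ Ex G := mul_le_mul_of_nonneg_left (Finset.sum_le_sum fun x _ => h x) (by positivity)

lemma Ex_const {ι : Type*} [Fintype ι] [DecidableEq ι] (c : ℝ) :
    Ex (fun _ : ι → Bool => c) = c := by
  simp [Ex]

lemma Ex_add {ι : Type*} [Fintype ι] [DecidableEq ι] (F G : (ι → Bool) → ℝ) :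
    Ex (fun x => F x + G x) = Ex F + Ex G := by
  simp [Ex, Finset.sum_add_distrib, mul_add]

lemma Ex_mul {ι : Type*} [Fintype ι] [DecidableEq ι] (c : ℝ) (F : (ι → Bool) → ℝ) :
    Ex (fun x => c * F x) = c * Ex F := by
  simp [Ex, ← Finset.mul_sum]; ring

lemma sum_fin_succ {m : ℕ} (F : (Fin (m+1) → Bool) → ℝ) :
    ∑ x, F x = ∑ x : Fin m → Bool, (F (Fin.cons true x) + F (Fin.cons false x)) := by
  rw [← (Fin.consEquiv (fun _ => Bool)).sum_comp, Fintype.sum_prod_type, Fintype.sum_bool,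
    ← Finset.sum_add_distrib]
  rfl

lemma Ex_fin_succ {m : ℕ} (F : (Fin (m+1) → Bool) → ℝ) :
    Ex F = Ex (fun x : Fin m → Bool => (F (Fin.cons true x) + F (Fin.cons false x)) / 2) := by
  rw [Ex, Ex, sum_fin_succ, ← Finset.sum_div]
  simp [pow_succ]; ring

lemma KK_fin_succ {m : ℕ} (s : ℝ) (F G : (Fin (m+1) → Bool) → ℝ) :
    KK s F G = (
      (1 + s) * (KK s (fun x => F (Fin.cons true x)) (fun x => G (Fin.cons true x)) +
        KK s (fun x => F (Fin.cons false x)) (fun x => G (Fin.cons false x))) +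
      (1 - s) * (KK s (fun x => F (Fin.cons true x)) (fun x => G (Fin.cons false x)) +
        KK s (fun x => F (Fin.cons false x)) (fun x => G (Fin.cons true x)))) / 4 := by
  simp only [KK]
  rw [sum_fin_succ]
  simp only [sum_fin_succ (m := m), Fin.prod_univ_succ, Fin.cons_zero, Fin.cons_succ, sg_true,
    sg_false, Fintype.card_fin, pow_succ, Finset.mul_sum, mul_add, ← Finset.sum_add_distrib,
    add_div, Finset.sum_div]
  refine Finset.sum_congr rfl fun x _ => Finset.sum_congr rfl fun y _ => ?_
  ring

lemma rpow_avg_nonneg {ι : Type*} [Fintype ι] [DecidableEq ι] {F : (ι → Bool) → ℝ} (hF : ∀ x, 0 ≤ F x) (p q : ℝ) :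
    0 ≤ (Ex (fun x => F x ^ p)) ^ q :=
  Real.rpow_nonneg (Ex_nonneg fun x => Real.rpow_nonneg (hF x) _) _

lemma hyper_fin {s : ℝ} (hs0 : 0 < s) (hs1 : s < 1) (m : ℕ) (F G : (Fin m → Bool) → ℝ)
    (hF : ∀ x, 0 ≤ F x) (hG : ∀ x, 0 ≤ G x) :
    KK s F G ≤ (Ex (fun x => F x ^ (1 + s))) ^ (1 / (1 + s)) *
      (Ex (fun x => G x ^ (1 + s))) ^ (1 / (1 + s)) := by
  induction m with
  | zero =>
    have h : (1 + s) * (1 / (1 + s)) = 1 := by field_simp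
    simp only [KK, Ex, Fintype.sum_unique, Fintype.card_fin, pow_zero, inv_one, one_mul]
    rw [← Real.rpow_mul (hF _), ← Real.rpow_mul (hG _), h]
    simp
  | succ m ih =>
    rw [KK_fin_succ, Ex_fin_succ, Ex_fin_succ (fun x => G x ^ (1 + s))]
    set a := (Ex (fun x => F (Fin.cons true x) ^ (1 + s))) ^ (1 / (1 + s)) with ha
    set b := (Ex (fun x => F (Fin.cons false x) ^ (1 + s))) ^ (1 / (1 + s)) with hb
    set c := (Ex (fun x => G (Fin.cons true x) ^ (1 + s))) ^ (1 / (1 + s)) with hc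
    set d := (Ex (fun x => G (Fin.cons false x) ^ (1 + s))) ^ (1 / (1 + s)) with hd
    have h1 := ih (fun x => F (Fin.cons true x)) (fun x => G (Fin.cons true x))
      (fun _ => hF _) (fun _ => hG _)
    have h2 := ih (fun x => F (Fin.cons false x)) (fun x => G (Fin.cons false x))
      (fun _ => hF _) (fun _ => hG _)
    have h3 := ih (fun x => F (Fin.cons true x)) (fun x => G (Fin.cons false x))
      (fun _ => hF _) (fun _ => hG _)
    have h4 := ih (fun x => F (Fin.cons false x)) (fun x => G (Fin.cons true x))
      (fun _ => hF _) (fun _ => hG _)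
    have a0 : 0 ≤ a := rpow_avg_nonneg (fun _ => hF _) _ _
    have b0 : 0 ≤ b := rpow_avg_nonneg (fun _ => hF _) _ _
    have c0 : 0 ≤ c := rpow_avg_nonneg (fun _ => hG _) _ _
    have d0 : 0 ≤ d := rpow_avg_nonneg (fun _ => hG _) _ _
    have pw : ∀ H : (Fin m → Bool) → ℝ, (∀ x, 0 ≤ H x) →
        ((Ex (fun x => H x ^ (1 + s))) ^ (1 / (1 + s))) ^ (1 + s) = Ex (fun x => H x ^ (1 + s)) := by
      intro H hH
      rw [← Real.rpow_mul (Ex_nonneg fun x => Real.rpow_nonneg (hH x) _)]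
      rw [one_div_mul_cancel (by positivity), Real.rpow_one]
    have avg : ∀ H K : (Fin m → Bool) → ℝ,
        Ex (fun x => (H x + K x) / 2) = (Ex H + Ex K) / 2 := by
      intro H K
      simp [Ex, ← Finset.sum_div, Finset.sum_add_distrib]; ring
    have tp := two_point hs0 hs1 a0 b0 c0 d0
    rw [ha, hb, hc, hd, pw _ (fun _ => hF _), pw _ (fun _ => hF _), pw _ (fun _ => hG _),
      pw _ (fun _ => hG _), ← avg, ← avg, ← ha, ← hb, ← hc, ← hd] at tp
    refine le_trans ?_ tp
    gcongr

lemma hyper_gen {ι : Type*} [Fintype ι] [DecidableEq ι] {s : ℝ} (hs0 : 0 < s) (hs1 : s < 1)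
    (F G : (ι → Bool) → ℝ)
    (hF : ∀ x, 0 ≤ F x) (hG : ∀ x, 0 ≤ G x) :
    KK s F G ≤ (Ex (fun x => F x ^ (1 + s))) ^ (1 / (1 + s)) *
      (Ex (fun x => G x ^ (1 + s))) ^ (1 / (1 + s)) := by
  let e := Fintype.equivFin ι
  let E : (Fin (Fintype.card ι) → Bool) ≃ (ι → Bool) := e.symm.arrowCongr (Equiv.refl _)
  have hE : ∀ F : (ι → Bool) → ℝ, Ex F = Ex (fun x => F (E x)) := by
    intro F; simp only [Ex, Fintype.card_fin]; rw [E.sum_comp]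
  have hK : KK s F G = KK s (fun x => F (E x)) (fun x => G (E x)) := by
    simp only [KK, Fintype.card_fin]
    rw [← E.sum_comp]
    congr 1
    refine Finset.sum_congr rfl fun x _ => ?_
    rw [← E.sum_comp]
    refine Finset.sum_congr rfl fun y _ => ?_
    congr 1
    rw [← e.prod_comp]
    rfl
  rw [hK, hE, hE (fun x => G x ^ (1 + s))]
  exact hyper_fin hs0 hs1 _ _ _ (fun _ => hF _) (fun _ => hG _)

/-- the interpolated bound -/
def psi (A B s : ℝ) : ℝ := A ^ (2 * (1 - s) / (1 + s)) * B ^ (2 * s / (1 + s))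

lemma psi_mono {A B A' B' s : ℝ} (hs0 : 0 < s) (hs1 : s < 1) (hA : 0 ≤ A) (hB : 0 ≤ B)
    (hAA : A ≤ A') (hBB : B ≤ B') : psi A B s ≤ psi A' B' s := by
  unfold psi
  have : 0 ≤ 1 - s := by linarith
  have hA' : 0 ≤ A' := hA.trans hAA
  gcongr

lemma Ex_holder {ι : Type*} [Fintype ι] [DecidableEq ι] {s : ℝ} (hs0 : 0 < s) (hs1 : s < 1)
    (F : (ι → Bool) → ℝ) (hF : ∀ x, 0 ≤ F x) :
    Ex (fun x => F x ^ (1 + s)) ≤ (Ex F) ^ (1 - s) * (Ex (fun x => F x ^ 2)) ^ s := by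
  have hpq : Real.HolderConjugate (1 / (1 - s)) (1 / s) := by
    rw [Real.holderConjugate_iff]
    constructor
    · rw [lt_div_iff₀] <;> linarith
    · simp
  have h := Real.inner_le_Lp_mul_Lq_of_nonneg (Finset.univ) hpq
    (f := fun x => F x ^ (1 - s)) (g := fun x => F x ^ (2 * s))
    (fun x _ => Real.rpow_nonneg (hF x) _) (fun x _ => Real.rpow_nonneg (hF x) _)
  have e1 : ∀ x, F x ^ (1 - s) * F x ^ (2 * s) = F x ^ (1 + s) := by
    intro x
    rw [← Real.rpow_add_of_nonneg (hF x) (by linarith) (by linarith)]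
    congr 1; ring
  have e2 : ∀ x, (F x ^ (1 - s)) ^ (1 / (1 - s)) = F x := by
    intro x
    rw [← Real.rpow_mul (hF x), mul_one_div_cancel (by linarith), Real.rpow_one]
  have e3 : ∀ x, (F x ^ (2 * s)) ^ (1 / s) = F x ^ 2 := by
    intro x
    rw [← Real.rpow_mul (hF x), mul_assoc, mul_one_div_cancel (by linarith), mul_one]
    norm_cast
  simp only [e1, e2, e3, one_div_one_div] at h
  have hc : (0:ℝ) ≤ (2 ^ Fintype.card ι)⁻¹ := by positivity
  unfold Ex
  rw [Real.mul_rpow hc (Finset.sum_nonneg fun x _ => hF x),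
    Real.mul_rpow hc (Finset.sum_nonneg fun x _ => sq_nonneg _)]
  calc _ ≤ (2 ^ Fintype.card ι : ℝ)⁻¹ * ((∑ i, F i) ^ (1 - s) * (∑ i, F i ^ 2) ^ s) :=
        mul_le_mul_of_nonneg_left h hc
    _ = _ := by
      have : (2 ^ Fintype.card ι : ℝ)⁻¹ = ((2 ^ Fintype.card ι : ℝ)⁻¹) ^ (1 - s) * ((2 ^ Fintype.card ι : ℝ)⁻¹) ^ s := by
        rw [← Real.rpow_add (by positivity)]; simp
      nth_rw 1 [this]
      ring

lemma KK_le_psi {ι : Type*} [Fintype ι] [DecidableEq ι] {s : ℝ} (hs0 : 0 < s) (hs1 : s < 1)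
    (F : (ι → Bool) → ℝ) :
    KK s F F ≤ psi (Ex (fun x => |F x|)) (Ex (fun x => F x ^ 2)) s := by
  have h1 : KK s F F ≤ KK s (fun x => |F x|) (fun x => |F x|) := by
    unfold KK
    refine mul_le_mul_of_nonneg_left ?_ (by positivity)
    refine Finset.sum_le_sum fun x _ => Finset.sum_le_sum fun y _ => ?_
    refine mul_le_mul_of_nonneg_right ?_ ?_
    · rw [← abs_mul]; exact le_abs_self _
    · refine Finset.prod_nonneg fun k _ => ?_
      cases x k <;> cases y k <;> simp <;> linarith
  refine h1.trans ((hyper_gen hs0 hs1 _ _ (fun x => abs_nonneg _) (fun x => abs_nonneg _)).trans ?_)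
  have h2 := Ex_holder hs0 hs1 (fun x => |F x|) (fun x => abs_nonneg _)
  simp only [sq_abs] at h2
  have n0 : 0 ≤ Ex (fun x => |F x| ^ (1 + s)) := Ex_nonneg fun x => by positivity
  have n1 : 0 ≤ Ex (fun x => |F x|) := Ex_nonneg fun x => by positivity
  have n2 : 0 ≤ Ex (fun x => F x ^ 2) := Ex_nonneg fun x => by positivity
  rw [← Real.rpow_add_of_nonneg n0 (by positivity) (by positivity)]
  refine (Real.rpow_le_rpow n0 h2 (by positivity)).trans (le_of_eq ?_)
  rw [Real.mul_rpow (by positivity) (by positivity), ← Real.rpow_mul n1, ← Real.rpow_mul n2, psi]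
  congr 2 <;> ring

/-- flip coordinate k -/
def flp {ι : Type*} [DecidableEq ι] (k : ι) (x : ι → Bool) : ι → Bool := Function.update x k (!x k)

lemma flp_invol {ι : Type*} [DecidableEq ι] (k : ι) : Function.Involutive (flp k) := by
  intro x; ext j; by_cases h : j = k
  · subst h; simp [flp]
  · simp [flp, h]

lemma flp_same {ι : Type*} [DecidableEq ι] (k : ι) (x : ι → Bool) : flp k x k = !x k := by simp [flp]
lemma flp_ne {ι : Type*} [DecidableEq ι] {k j : ι} (h : j ≠ k) (x : ι → Bool) : flp k x j = x j := by
  simp [flp, h]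

lemma sum_flp {ι : Type*} [Fintype ι] [DecidableEq ι] (k : ι) (H : (ι → Bool) → ℝ) :
    ∑ x, H (flp k x) = ∑ x, H x :=
  Equiv.sum_comp (flp_invol k).toPerm H

/-- discrete derivative -/
def dk {ι : Type*} [DecidableEq ι] (k : ι) (F : (ι → Bool) → ℝ) (x : ι → Bool) : ℝ :=
  (F x - F (flp k x)) * sg (x k) / 2

lemma dk_flp {ι : Type*} [DecidableEq ι] (k : ι) (F : (ι → Bool) → ℝ) (x : ι → Bool) :
    dk k F (flp k x) = dk k F x := by
  unfold dk; rw [flp_invol k x, flp_same, sg_not]; ring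

lemma sum_sg_eq_dk {ι : Type*} [Fintype ι] [DecidableEq ι] (k : ι) (F W : (ι → Bool) → ℝ)
    (hW : ∀ x, W (flp k x) = W x) :
    ∑ x, F x * sg (x k) * W x = ∑ x, dk k F x * W x := by
  have h := sum_flp k (fun x => F x * sg (x k) * W x)
  have h2 : ∑ x, dk k F x * W x =
      (∑ x, F x * sg (x k) * W x + ∑ x, F (flp k x) * sg (flp k x k) * W (flp k x)) / 2 := by
    rw [← Finset.sum_add_distrib, Finset.sum_div]
    refine Finset.sum_congr rfl fun x _ => ?_
    rw [hW, flp_same, sg_not, dk]; ring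
  rw [h2, h]; ring

lemma sum_sg_dk {ι : Type*} [Fintype ι] [DecidableEq ι] (k : ι) (F W : (ι → Bool) → ℝ)
    (hW : ∀ x, W (flp k x) = W x) :
    ∑ x, dk k F x * sg (x k) * W x = 0 := by
  have h := sum_flp k (fun x => dk k F x * sg (x k) * W x)
  simp only [dk_flp, hW, flp_same, sg_not] at h
  have h2 : ∑ x, dk k F x * -sg (x k) * W x = - ∑ x, dk k F x * sg (x k) * W x := by
    rw [← Finset.sum_neg_distrib]; exact Finset.sum_congr rfl fun x _ => by ring
  linarith

/-- partial weight -/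
def Wt {ι : Type*} [Fintype ι] [DecidableEq ι] (s : ℝ) (k : ι) (x y : ι → Bool) : ℝ :=
  ∏ j ∈ Finset.univ.erase k, (1 + s * (sg (x j) * sg (y j)))

lemma Wt_l {ι : Type*} [Fintype ι] [DecidableEq ι] (s : ℝ) (k : ι) (x y : ι → Bool) :
    Wt s k (flp k x) y = Wt s k x y := by
  unfold Wt
  refine Finset.prod_congr rfl fun j hj => ?_
  rw [flp_ne (Finset.ne_of_mem_erase hj)]

lemma Wt_r {ι : Type*} [Fintype ι] [DecidableEq ι] (s : ℝ) (k : ι) (x y : ι → Bool) :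
    Wt s k x (flp k y) = Wt s k x y := by
  unfold Wt
  refine Finset.prod_congr rfl fun j hj => ?_
  rw [flp_ne (Finset.ne_of_mem_erase hj)]

lemma KK_dk {ι : Type*} [Fintype ι] [DecidableEq ι] (s : ℝ) (k : ι) (F : (ι → Bool) → ℝ) :
    ∑ x, ∑ y, F x * F y * (Wt s k x y * (sg (x k) * sg (y k))) =
    ∑ x, ∑ y, dk k F x * dk k F y * ∏ j, (1 + s * (sg (x j) * sg (y j))) := by
  have h1 : ∀ x y : ι → Bool, ∏ j, (1 + s * (sg (x j) * sg (y j))) =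
      (1 + s * (sg (x k) * sg (y k))) * Wt s k x y := by
    intro x y
    exact (Finset.mul_prod_erase Finset.univ (fun j => 1 + s * (sg (x j) * sg (y j)))
      (Finset.mem_univ k)).symm
  have L1 : ∑ x, ∑ y, F x * F y * (Wt s k x y * (sg (x k) * sg (y k))) =
      ∑ x, ∑ y, dk k F x * dk k F y * Wt s k x y := by
    have : ∀ x, ∑ y, F x * F y * (Wt s k x y * (sg (x k) * sg (y k))) =
        F x * sg (x k) * ∑ y, dk k F y * Wt s k x y := by
      intro x
      rw [← sum_sg_eq_dk k F (fun y => Wt s k x y) (fun y => Wt_r s k x y), Finset.mul_sum]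
      exact Finset.sum_congr rfl fun y _ => by ring
    simp only [this]
    rw [sum_sg_eq_dk k F (fun x => ∑ y, dk k F y * Wt s k x y) (fun x => by simp only [Wt_l])]
    refine Finset.sum_congr rfl fun x _ => ?_
    rw [Finset.mul_sum]
    exact Finset.sum_congr rfl fun y _ => by ring
  have L2 : ∑ x, ∑ y, dk k F x * dk k F y * (s * (sg (x k) * sg (y k)) * Wt s k x y) = 0 := by
    refine Finset.sum_eq_zero fun x _ => ?_
    have := sum_sg_dk k F (fun y => Wt s k x y) (fun y => Wt_r s k x y)
    calc _ = (dk k F x * s * sg (x k)) * ∑ y, dk k F y * sg (y k) * Wt s k x y := by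
          rw [Finset.mul_sum]; exact Finset.sum_congr rfl fun y _ => by ring
      _ = 0 := by rw [this, mul_zero]
  rw [L1, ← add_zero (∑ x, ∑ y, dk k F x * dk k F y * Wt s k x y), ← L2, ← Finset.sum_add_distrib]
  refine Finset.sum_congr rfl fun x _ => ?_
  rw [← Finset.sum_add_distrib]
  refine Finset.sum_congr rfl fun y _ => ?_
  rw [h1]; ring

lemma hasDerivAt_KK {ι : Type*} [Fintype ι] [DecidableEq ι] (s : ℝ) (F : (ι → Bool) → ℝ) :
    HasDerivAt (fun s => KK s F F) (∑ k, KK s (dk k F) (dk k F)) s := by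
  have hp : ∀ x y : ι → Bool, HasDerivAt (fun s => ∏ k, (1 + s * (sg (x k) * sg (y k))))
      (∑ k, Wt s k x y * (sg (x k) * sg (y k))) s := by
    intro x y
    have := HasDerivAt.fun_finsetProd (u := Finset.univ) (x := s)
      (f := fun k s => 1 + s * (sg (x k) * sg (y k))) (f' := fun k => sg (x k) * sg (y k))
      (fun k _ => by
        simpa using ((hasDerivAt_id s).mul_const (sg (x k) * sg (y k))).const_add 1)
    simpa [Wt] using this
  have h := (HasDerivAt.fun_sum (u := Finset.univ) (x := s) fun (x : ι → Bool) _ =>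
    HasDerivAt.fun_sum (u := Finset.univ) fun (y : ι → Bool) _ =>
      (hp x y).const_mul (F x * F y)).const_mul ((4 ^ Fintype.card ι : ℝ)⁻¹)
  unfold KK
  convert! h using 1
  rw [← Finset.mul_sum]
  congr 1
  simp only [← KK_dk, Finset.mul_sum]
  rw [Finset.sum_comm]
  refine Finset.sum_congr rfl fun x _ => ?_
  rw [Finset.sum_comm]

lemma KK_zero {ι : Type*} [Fintype ι] [DecidableEq ι] (F : (ι → Bool) → ℝ) :
    KK 0 F F = (Ex F) ^ 2 := by
  simp only [KK, Ex, zero_mul, add_zero, Finset.prod_const_one, mul_one, ← Finset.sum_mul_sum]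
  rw [show (4:ℝ) = 2 * 2 by norm_num, mul_pow]
  field_simp

lemma KK_one {ι : Type*} [Fintype ι] [DecidableEq ι] (F : (ι → Bool) → ℝ) :
    KK 1 F F = Ex (fun x => F x ^ 2) := by
  have h : ∀ x y : ι → Bool, ∏ k, (1 + 1 * (sg (x k) * sg (y k))) =
      if x = y then (2:ℝ) ^ Fintype.card ι else 0 := by
    intro x y
    split_ifs with hxy
    · subst hxy; simp [sg_mul_self, one_add_one_eq_two]
    · obtain ⟨k, hk⟩ := Function.ne_iff.1 hxy
      refine Finset.prod_eq_zero (Finset.mem_univ k) ?_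
      revert hk
      cases x k <;> cases y k <;> simp
  simp only [KK, Ex, h]
  simp only [mul_ite, mul_zero, Finset.sum_ite_eq, Finset.mem_univ, if_true, ← Finset.sum_mul]
  rw [show (4:ℝ) = 2 * 2 by norm_num, mul_pow]
  field_simp

lemma continuous_KK {ι : Type*} [Fintype ι] [DecidableEq ι] (F : (ι → Bool) → ℝ) :
    Continuous (fun s => KK s F F) :=
  continuous_iff_continuousAt.2 fun s => (hasDerivAt_KK s F).continuousAt

lemma psi_continuousOn {A B : ℝ} (hA : 0 < A) (hB : 0 < B) :
    ContinuousOn (psi A B) (Set.Icc 0 1) := by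
  unfold psi
  have h : ∀ s ∈ Set.Icc (0:ℝ) 1, 1 + s ≠ 0 := fun s hs => by linarith [hs.1]
  refine ContinuousOn.mul ?_ ?_
  · refine ContinuousOn.rpow continuousOn_const (ContinuousOn.div (by fun_prop) (by fun_prop) h) ?_
    exact fun _ _ => Or.inl hA.ne'
  · refine ContinuousOn.rpow continuousOn_const (ContinuousOn.div (by fun_prop) (by fun_prop) h) ?_
    exact fun _ _ => Or.inl hB.ne'

lemma psi_intervalIntegrable {A B : ℝ} (hA : 0 < A) (hB : 0 < B) :
    IntervalIntegrable (psi A B) volume 0 1 := by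
  apply ContinuousOn.intervalIntegrable
  rw [Set.uIcc_of_le zero_le_one]
  exact psi_continuousOn hA hB

lemma cube_ineq {ι : Type*} [Fintype ι] [DecidableEq ι] (F : (ι → Bool) → ℝ) (A B : ι → ℝ)
    (hA : ∀ k, 0 < A k) (hB : ∀ k, 0 < B k)
    (h1 : ∀ k, Ex (fun x => |dk k F x|) ≤ A k) (h2 : ∀ k, Ex (fun x => dk k F x ^ 2) ≤ B k) :
    Ex (fun x => F x ^ 2) - (Ex F) ^ 2 ≤ ∑ k, ∫ s in (0:ℝ)..1, psi (A k) (B k) s := by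
  have hc : Continuous (fun s => ∑ k, KK s (dk k F) (dk k F)) :=
    continuous_finsetSum _ fun k _ => continuous_KK _
  have h := intervalIntegral.integral_eq_sub_of_hasDerivAt (a := 0) (b := 1)
    (f := fun s => KK s F F) (f' := fun s => ∑ k, KK s (dk k F) (dk k F))
    (fun s _ => hasDerivAt_KK s F) (hc.intervalIntegrable _ _)
  simp only [KK_one, KK_zero] at h
  rw [← h, ← intervalIntegral.integral_finsetSum (fun k _ => psi_intervalIntegrable (hA k) (hB k))]
  apply intervalIntegral.integral_mono_on_of_le_Ioo zero_le_one (hc.intervalIntegrable _ _)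
  · convert! IntervalIntegrable.sum (Finset.univ) (fun k _ => psi_intervalIntegrable (hA k) (hB k)) using 1
    ext s; simp
  · intro s hs
    refine Finset.sum_le_sum fun k _ => ?_
    refine (KK_le_psi hs.1 hs.2 (dk k F)).trans (psi_mono hs.1 hs.2 ?_ ?_ (h1 k) (h2 k))
    · exact Ex_nonneg fun x => abs_nonneg _
    · exact Ex_nonneg fun x => sq_nonneg _

/-- normalized sums -/
def SN (d N : ℕ) (x : Fin d × Fin N → Bool) : EuclideanSpace ℝ (Fin d) :=
  WithLp.toLp 2 (fun i => (√(N:ℝ))⁻¹ * ∑ k, sg (x (i, k)))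

lemma SN_apply (d N : ℕ) (x : Fin d × Fin N → Bool) (i : Fin d) :
    SN d N x i = (√(N:ℝ))⁻¹ * ∑ k, sg (x (i, k)) := rfl

/-- law of normalized sums -/
def muN (d N : ℕ) : Measure (EuclideanSpace ℝ (Fin d)) :=
  ((2 ^ Fintype.card (Fin d × Fin N) : NNReal)⁻¹) • ∑ x : Fin d × Fin N → Bool, Measure.dirac (SN d N x)

lemma integral_muN {V : Type*} [NormedAddCommGroup V] [NormedSpace ℝ V] [CompleteSpace V] (d N : ℕ)
    (f : EuclideanSpace ℝ (Fin d) → V) :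
    ∫ y, f y ∂(muN d N) = ((2 ^ Fintype.card (Fin d × Fin N) : ℝ)⁻¹) • ∑ x : Fin d × Fin N → Bool, f (SN d N x) := by
  rw [muN, integral_smul_nnreal_measure, integral_finsetSum_measure]
  · simp only [integral_dirac]
    rw [NNReal.smul_def]; simp
  · intro x _
    exact integrable_dirac (by simp)

instance (d N : ℕ) : IsProbabilityMeasure (muN d N) := by
  constructor
  rw [muN]
  simp only [Measure.smul_apply, Measure.finsetSum_apply, measure_univ, Finset.sum_const,
    Finset.card_univ, Fintype.card_fun, Fintype.card_bool]
  rw [ENNReal.smul_def]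
  simp
  rw [ENNReal.inv_mul_cancel] <;> simp

/-- Rademacher law -/
def radB : Measure Bool := ((2 : NNReal)⁻¹) • (Measure.dirac true + Measure.dirac false)

lemma integral_radB {V : Type*} [NormedAddCommGroup V] [NormedSpace ℝ V] [CompleteSpace V]
    (f : Bool → V) : ∫ b, f b ∂radB = (2⁻¹ : ℝ) • (f true + f false) := by
  rw [radB, integral_smul_nnreal_measure, integral_add_measure]
  · simp only [integral_dirac]
    rw [NNReal.smul_def]; simp
  · exact integrable_dirac (by simp)
  · exact integrable_dirac (by simp)

instance : IsProbabilityMeasure radB := by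
  constructor
  rw [radB]
  simp only [Measure.smul_apply, Measure.add_apply, measure_univ]
  rw [ENNReal.smul_def]
  simp [one_add_one_eq_two]
  rw [ENNReal.inv_mul_cancel] <;> simp

lemma measurable_sg : Measurable sg := measurable_of_finite _

lemma tendsto_cos_pow (t : ℝ) :
    Tendsto (fun N : ℕ => ((2⁻¹ : ℂ) * (Complex.exp (((√(N:ℝ))⁻¹ * t : ℝ) * Complex.I)
      + Complex.exp (-(((√(N:ℝ))⁻¹ * t : ℝ) * Complex.I)))) ^ N) atTop
      (𝓝 (Complex.exp (- (t:ℂ) ^ 2 / 2))) := by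
  have h := tendsto_charFun_inv_sqrt_mul_pow (P := radB) (X := sg) measurable_sg.aemeasurable
    (by rw [integral_radB]; simp) (by rw [integral_radB]; simp; norm_num) t
  convert h using 3 with N
  rw [charFun_apply_real, integral_map measurable_sg.aemeasurable (by fun_prop), integral_radB]
  simp [mul_add]

lemma charFun_muN (d N : ℕ) (t : EuclideanSpace ℝ (Fin d)) :
    charFun (muN d N) t = ∏ i, ((2⁻¹ : ℂ) * (Complex.exp (((√(N:ℝ))⁻¹ * t i : ℝ) * Complex.I)
      + Complex.exp (-(((√(N:ℝ))⁻¹ * t i : ℝ) * Complex.I)))) ^ N := by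
  rw [charFun_apply, integral_muN]
  have h1 : ∀ x : Fin d × Fin N → Bool, Complex.exp (((inner ℝ (SN d N x) t : ℝ) : ℂ) * Complex.I) =
      ∏ q : Fin d × Fin N, Complex.exp (((√(N:ℝ))⁻¹ * t q.1 * sg (x q) : ℝ) * Complex.I) := by
    intro x
    rw [← Complex.exp_sum]
    congr 1
    rw [← Finset.sum_mul]
    congr 1
    rw [PiLp.inner_apply, Fintype.sum_prod_type]
    push_cast
    refine Finset.sum_congr rfl fun i _ => ?_
    rw [SN_apply]
    simp only [RCLike.inner_apply, conj_trivial]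
    push_cast
    rw [← Finset.mul_sum]
    ring
  simp only [h1]
  have h2 := Finset.prod_univ_sum (ι := Fin d × Fin N) (t := fun _ => (Finset.univ : Finset Bool))
    (f := fun q b => Complex.exp (((√(N:ℝ))⁻¹ * t q.1 * sg b : ℝ) * Complex.I))
  rw [Fintype.piFinset_univ] at h2
  rw [← h2]
  simp only [Fintype.sum_bool, sg_true, sg_false]
  rw [Fintype.prod_prod_type]
  simp only [Finset.prod_const, Finset.card_univ, Fintype.card_fin, mul_pow, Finset.prod_mul_distrib]
  simp only [Fintype.card_prod, Fintype.card_fin, Complex.real_smul]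
  congr 1
  · push_cast
    rw [← pow_mul, mul_comm N d, inv_pow]
  · simp

/-- bundled law -/
def muP (d N : ℕ) : ProbabilityMeasure (EuclideanSpace ℝ (Fin d)) := ⟨muN d N, inferInstance⟩

lemma coe_muP (d N : ℕ) : ((muP d N : ProbabilityMeasure _) : Measure (EuclideanSpace ℝ (Fin d))) = muN d N := rfl

lemma clt (d : ℕ) (γ : ProbabilityMeasure (EuclideanSpace ℝ (Fin d)))
    (hγ : ∀ t, charFun (γ : Measure (EuclideanSpace ℝ (Fin d))) t = Complex.exp (-(‖t‖:ℂ) ^ 2 / 2))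
    (f : EuclideanSpace ℝ (Fin d) → ℝ) (hf : Continuous f) (C : ℝ) (hC : ∀ x, |f x| ≤ C) :
    Tendsto (fun N : ℕ => Ex (fun x => f (SN d N x))) atTop (𝓝 (∫ y, f y ∂(γ : Measure _))) := by
  have h : Tendsto (fun N : ℕ => muP d N)
      atTop (𝓝 γ) := by
    rw [ProbabilityMeasure.tendsto_iff_tendsto_charFun]
    intro t
    rw [hγ]
    simp only [coe_muP, charFun_muN]
    have := tendsto_finsetProd (Finset.univ) fun i (_ : i ∈ Finset.univ) => tendsto_cos_pow (t i)
    convert this using 2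
    rw [← Complex.exp_sum]
    congr 1
    rw [← Complex.ofReal_pow, EuclideanSpace.norm_sq_eq]
    push_cast
    rw [← Finset.sum_div, ← Finset.sum_neg_distrib]
    simp [← Complex.ofReal_pow]
  rw [ProbabilityMeasure.tendsto_iff_forall_integral_tendsto] at h
  have := h (BoundedContinuousFunction.ofNormedAddCommGroup f hf C hC)
  simpa [integral_muN, Ex, coe_muP] using this

lemma psi_scale {A B r s : ℝ} (hA : 0 ≤ A) (hB : 0 ≤ B) (hr : 0 < r) (hs : 0 ≤ s) :
    psi (r * A) (r ^ 2 * B) s = r ^ 2 * psi A B s := by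
  unfold psi
  rw [Real.mul_rpow hr.le hA, Real.mul_rpow (by positivity) hB]
  have : r ^ (2 * (1 - s) / (1 + s)) * (r ^ 2) ^ (2 * s / (1 + s)) = r ^ 2 := by
    rw [← Real.rpow_natCast r 2, ← Real.rpow_mul hr.le, ← Real.rpow_add hr]
    congr 1
    push_cast
    field_simp
    ring
  calc _ = (r ^ (2 * (1 - s) / (1 + s)) * (r ^ 2) ^ (2 * s / (1 + s))) *
        (A ^ (2 * (1 - s) / (1 + s)) * B ^ (2 * s / (1 + s))) := by ring
    _ = _ := by rw [this]

lemma SN_flp (d N : ℕ) (x : Fin d × Fin N → Bool) (i : Fin d) (j : Fin N) :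
    SN d N (flp (i, j) x) = SN d N x + (-(2 * (√(N:ℝ))⁻¹ * sg (x (i, j)))) • EuclideanSpace.single i (1:ℝ) := by
  ext l
  simp only [SN_apply, PiLp.add_apply, PiLp.smul_apply, PiLp.single_apply, smul_eq_mul]
  by_cases hl : l = i
  · subst hl
    rw [← Finset.add_sum_erase _ _ (Finset.mem_univ j),
      ← Finset.add_sum_erase (Finset.univ) (fun k => sg (x (l, k))) (Finset.mem_univ j)]
    have : ∑ k ∈ Finset.univ.erase j, sg (flp (l, j) x (l, k)) = ∑ k ∈ Finset.univ.erase j, sg (x (l, k)) := by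
      refine Finset.sum_congr rfl fun k hk => ?_
      rw [flp_ne]
      have := Finset.ne_of_mem_erase hk
      simpa using this
    rw [this, flp_same, sg_not]
    simp
    ring
  · simp only [hl, if_false, mul_zero, add_zero]
    congr 1
    refine Finset.sum_congr rfl fun k hk => ?_
    rw [flp_ne]
    simp [hl]

lemma abs_sg (b : Bool) : |sg b| = 1 := by cases b <;> simp

lemma dk_close {d N : ℕ} (hN : 0 < N) (f : EuclideanSpace ℝ (Fin d) → ℝ) (h : EuclideanSpace ℝ (Fin d) → ℝ)
    (i : Fin d)
    (hd : ∀ x t, HasDerivAt (fun t : ℝ => f (x + t • EuclideanSpace.single i (1:ℝ)))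
      (h (x + t • EuclideanSpace.single i (1:ℝ))) t)
    {ω δ : ℝ} (hω : ∀ x y, dist x y < δ → |h x - h y| ≤ ω)
    (hδ : 2 * (√(N:ℝ))⁻¹ < δ) (j : Fin N) (x : Fin d × Fin N → Bool) :
    |dk (i, j) (fun x => f (SN d N x)) x - (√(N:ℝ))⁻¹ * h (SN d N x)| ≤ (√(N:ℝ))⁻¹ * ω := by
  set r := (√(N:ℝ))⁻¹ with hr
  have hr0 : 0 < r := by positivity
  set e := EuclideanSpace.single (𝕜 := ℝ) i (1:ℝ) with he
  set S := SN d N x with hS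
  set τ := 2 * r * sg (x (i, j)) with hτ
  have hτa : |τ| = 2 * r := by rw [hτ, abs_mul, abs_sg, mul_one, abs_of_pos (by positivity)]
  have key := Convex.norm_image_sub_le_of_norm_hasDerivWithin_le
    (f := fun t : ℝ => f (S + t • e) - t * h S) (f' := fun t => h (S + t • e) - h S)
    (s := Set.Icc (-(2 * r)) (2 * r)) (C := ω) (x := -τ) (y := 0)
    (fun t ht => ((hd S t).sub (by simpa using (hasDerivAt_id t).mul_const (h S))).hasDerivWithinAt)
    (fun t ht => by
      rw [Real.norm_eq_abs]
      apply hω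
      rw [dist_eq_norm, add_sub_cancel_left, norm_smul, he]
      simp only [PiLp.norm_single, norm_one, mul_one, Real.norm_eq_abs]
      exact (abs_le.2 ht).trans_lt hδ)
    (convex_Icc _ _) (abs_le.1 (by rw [abs_neg, hτa])) ⟨by linarith, by linarith⟩
  have e1 : dk (i, j) (fun x => f (SN d N x)) x - r * h S =
      (sg (x (i, j)) / 2) * ((fun t : ℝ => f (S + t • e) - t * h S) 0 -
        (fun t : ℝ => f (S + t • e) - t * h S) (-τ)) := by
    simp only [dk, SN_flp]
    rw [← hr, ← hτ, ← he, ← hS]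
    simp only [zero_smul, add_zero, zero_mul]
    have := sg_mul_self (x (i, j))
    rw [hτ]
    linear_combination (r * h S) * this
  rw [e1, abs_mul, abs_div, abs_sg]
  rw [Real.norm_eq_abs, Real.norm_eq_abs, zero_sub, neg_neg, hτa] at key
  have : |(2:ℝ)| = 2 := abs_two
  rw [this]
  linarith

lemma gauss_ev {d : ℕ} (γ : ProbabilityMeasure (EuclideanSpace ℝ (Fin d)))
    (hγ : ∀ t, charFun (γ : Measure (EuclideanSpace ℝ (Fin d))) t = Complex.exp (-(‖t‖:ℂ) ^ 2 / 2))
    (f : EuclideanSpace ℝ (Fin d) → ℝ) (h : EuclideanSpace ℝ (Fin d) → ℝ)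
    (i : Fin d)
    (hd : ∀ x t, HasDerivAt (fun t : ℝ => f (x + t • EuclideanSpace.single i (1:ℝ)))
      (h (x + t • EuclideanSpace.single i (1:ℝ))) t)
    (hu : UniformContinuous h) {C : ℝ} (hC : ∀ x, |h x| ≤ C) {α β : ℝ}
    (hα : ∫ y, |h y| ∂(γ : Measure _) < α) (hβ : ∫ y, (h y) ^ 2 ∂(γ : Measure _) < β) :
    ∀ᶠ N : ℕ in atTop, ∀ j : Fin N,
      Ex (fun x => |dk (i, j) (fun x => f (SN d N x)) x|) ≤ (√(N:ℝ))⁻¹ * α ∧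
      Ex (fun x => (dk (i, j) (fun x => f (SN d N x)) x) ^ 2) ≤ ((√(N:ℝ))⁻¹) ^ 2 * β := by
  have hC0 : 0 ≤ C := (abs_nonneg _).trans (hC 0)
  obtain ⟨ω, hω0, hω1, hω2⟩ : ∃ ω > 0, ∫ y, |h y| ∂(γ : Measure _) + ω < α ∧
      ∫ y, (h y) ^ 2 ∂(γ : Measure _) + (2 * C * ω + ω ^ 2) < β := by
    have t1 : Tendsto (fun ω : ℝ => ∫ y, |h y| ∂(γ : Measure _) + ω) (𝓝[>] 0)
        (𝓝 (∫ y, |h y| ∂(γ : Measure _) + 0)) :=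
      tendsto_nhdsWithin_of_tendsto_nhds (Continuous.tendsto (by fun_prop) 0)
    have t2 : Tendsto (fun ω : ℝ => ∫ y, (h y) ^ 2 ∂(γ : Measure _) + (2 * C * ω + ω ^ 2)) (𝓝[>] 0)
        (𝓝 (∫ y, (h y) ^ 2 ∂(γ : Measure _) + (2 * C * 0 + 0 ^ 2))) :=
      tendsto_nhdsWithin_of_tendsto_nhds (Continuous.tendsto (by fun_prop) 0)
    have e1 := t1.eventually_lt_const (u := α) (by simpa using hα)
    have e2 := t2.eventually_lt_const (u := β) (by simpa using hβ)
    obtain ⟨ω, h1, h2, h3⟩ := (e1.and (e2.and self_mem_nhdsWithin)).exists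
    exact ⟨ω, h3, h1, h2⟩
  obtain ⟨δ, hδ0, hδ⟩ := Metric.uniformContinuous_iff.1 hu ω hω0
  have c1 := clt d γ hγ (fun y => |h y|) hu.continuous.abs C (fun x => by rw [abs_abs]; exact hC x)
  have c2 := clt d γ hγ (fun y => (h y) ^ 2) (hu.continuous.pow 2) (C ^ 2)
    (fun x => by rw [abs_pow]; exact pow_le_pow_left₀ (abs_nonneg _) (hC x) 2)
  have c3 : Tendsto (fun N : ℕ => 2 * (√(N:ℝ))⁻¹) atTop (𝓝 (2 * 0)) :=
    (tendsto_inv_atTop_zero.comp (Real.tendsto_sqrt_atTop.comp tendsto_natCast_atTop_atTop)).const_mul 2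
  have e1 := (c1.add_const ω).eventually_lt_const hω1
  have e2 := (c2.add_const (2 * C * ω + ω ^ 2)).eventually_lt_const hω2
  have e3 := c3.eventually_lt_const (u := δ) (by simpa using hδ0)
  filter_upwards [e1, e2, e3, eventually_gt_atTop 0] with N h1 h2 h3 hN j
  have hr0 : 0 < (√(N:ℝ))⁻¹ := by positivity
  have hcl := dk_close hN f h i hd (ω := ω) (δ := δ)
    (fun x y hxy => by have := hδ hxy; rw [Real.dist_eq] at this; exact this.le) h3 j
  have hab : ∀ x, |dk (i, j) (fun x => f (SN d N x)) x| ≤ (√(N:ℝ))⁻¹ * (|h (SN d N x)| + ω) := by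
    intro x
    have a1 := hcl x
    have a2 := abs_sub_abs_le_abs_sub (dk (i, j) (fun x => f (SN d N x)) x) ((√(N:ℝ))⁻¹ * h (SN d N x))
    rw [abs_mul, abs_of_pos hr0] at a2
    linarith
  constructor
  · refine (Ex_mono hab).trans ?_
    rw [Ex_mul, Ex_add, Ex_const]
    exact mul_le_mul_of_nonneg_left h1.le hr0.le
  · have : ∀ x, (dk (i, j) (fun x => f (SN d N x)) x) ^ 2 ≤
        ((√(N:ℝ))⁻¹) ^ 2 * (h (SN d N x) ^ 2 + (2 * C * ω + ω ^ 2)) := by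
      intro x
      rw [← sq_abs]
      refine (pow_le_pow_left₀ (abs_nonneg _) (hab x) 2).trans ?_
      rw [mul_pow]
      refine mul_le_mul_of_nonneg_left ?_ (by positivity)
      have := hC (SN d N x)
      have h5 := sq_abs (h (SN d N x))
      nlinarith [mul_le_mul_of_nonneg_right this hω0.le]
    refine (Ex_mono this).trans ?_
    rw [Ex_mul, Ex_add, Ex_const]
    exact mul_le_mul_of_nonneg_left h2.le (by positivity)

lemma gauss_ineq {d : ℕ} (γ : ProbabilityMeasure (EuclideanSpace ℝ (Fin d)))
    (hγ : ∀ t, charFun (γ : Measure (EuclideanSpace ℝ (Fin d))) t = Complex.exp (-(‖t‖:ℂ) ^ 2 / 2))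
    (f : EuclideanSpace ℝ (Fin d) → ℝ) (h : Fin d → EuclideanSpace ℝ (Fin d) → ℝ)
    (hd : ∀ i x t, HasDerivAt (fun t : ℝ => f (x + t • EuclideanSpace.single i (1:ℝ)))
      (h i (x + t • EuclideanSpace.single i (1:ℝ))) t)
    (hfc : Continuous f) {C : ℝ} (hfC : ∀ x, |f x| ≤ C)
    (hu : ∀ i, UniformContinuous (h i)) {C' : ℝ} (hC : ∀ i x, |h i x| ≤ C') {α β : Fin d → ℝ}
    (hα : ∀ i, ∫ y, |h i y| ∂(γ : Measure _) < α i)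
    (hβ : ∀ i, ∫ y, (h i y) ^ 2 ∂(γ : Measure _) < β i) :
    ∫ y, f y ^ 2 ∂(γ : Measure _) - (∫ y, f y ∂(γ : Measure _)) ^ 2 ≤
      ∑ i, ∫ s in (0:ℝ)..1, psi (α i) (β i) s := by
  have c1 := clt d γ hγ f hfc C hfC
  have c2 := clt d γ hγ (fun y => (f y) ^ 2) (hfc.pow 2) (C ^ 2)
    (fun x => by rw [abs_pow]; exact pow_le_pow_left₀ (abs_nonneg _) (hfC x) 2)
  have hev : ∀ᶠ N : ℕ in atTop, ∀ i, ∀ j : Fin N,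
      Ex (fun x => |dk (i, j) (fun x => f (SN d N x)) x|) ≤ (√(N:ℝ))⁻¹ * α i ∧
      Ex (fun x => (dk (i, j) (fun x => f (SN d N x)) x) ^ 2) ≤ ((√(N:ℝ))⁻¹) ^ 2 * β i :=
    eventually_all.2 fun i => gauss_ev γ hγ f (h i) i (hd i) (hu i) (hC i) (hα i) (hβ i)
  have hα0 : ∀ i, 0 < α i := fun i => (integral_nonneg fun _ => abs_nonneg _).trans_lt (hα i)
  have hβ0 : ∀ i, 0 < β i := fun i => (integral_nonneg fun _ => sq_nonneg _).trans_lt (hβ i)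
  refine le_of_tendsto (c2.sub (c1.pow 2)) ?_
  filter_upwards [hev, eventually_gt_atTop 0] with N hN hN0
  have hr0 : 0 < (√(N:ℝ))⁻¹ := by positivity
  have := cube_ineq (fun x => f (SN d N x)) (fun k => (√(N:ℝ))⁻¹ * α k.1)
    (fun k => ((√(N:ℝ))⁻¹) ^ 2 * β k.1)
    (fun k => mul_pos hr0 (hα0 _)) (fun k => mul_pos (by positivity) (hβ0 _))
    (fun k => (hN k.1 k.2).1) (fun k => (hN k.1 k.2).2)
  refine this.trans (le_of_eq ?_)
  rw [Fintype.sum_prod_type]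
  refine Finset.sum_congr rfl fun i _ => ?_
  simp only
  rw [Finset.sum_const, Finset.card_univ, Fintype.card_fin, nsmul_eq_mul,
    ← intervalIntegral.integral_const_mul]
  apply intervalIntegral.integral_congr
  intro s hs
  rw [Set.uIcc_of_le zero_le_one] at hs
  simp only
  rw [psi_scale (hα0 i).le (hβ0 i).le hr0 hs.1, inv_pow, Real.sq_sqrt (by positivity)]
  field_simp

/-- normalizing constant -/
def gcst (d : ℕ) : ℝ := ((2 * π) ^ ((d : ℝ) / 2))⁻¹

lemma gcst_pos (d : ℕ) : 0 < gcst d := by unfold gcst; positivity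

/-- radial Gaussian density -/
def gden (d : ℕ) (r : ℝ) : ℝ := gcst d * Real.exp (-(1/2) * r ^ 2)

lemma gden_pos (d : ℕ) (r : ℝ) : 0 < gden d r := mul_pos (gcst_pos d) (Real.exp_pos _)

lemma gden_cont (d : ℕ) : Continuous (gden d) := by unfold gden; fun_prop

/-- standard Gaussian by density -/
def gam (d : ℕ) : Measure (EuclideanSpace ℝ (Fin d)) :=
  volume.withDensity (fun x => ENNReal.ofReal (gden d ‖x‖))

lemma integral_gam {V : Type*} [NormedAddCommGroup V] [NormedSpace ℝ V] (d : ℕ)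
    (f : EuclideanSpace ℝ (Fin d) → V) :
    ∫ x, f x ∂(gam d) = ∫ x, gden d ‖x‖ • f x := by
  have hm : Measurable (fun x : EuclideanSpace ℝ (Fin d) => ENNReal.ofReal (gden d ‖x‖)) :=
    ((gden_cont d).comp continuous_norm).measurable.ennreal_ofReal
  rw [gam, integral_withDensity_eq_integral_toReal_smul hm (by simp)]
  simp only [ENNReal.toReal_ofReal (gden_pos _ _).le]

lemma integrable_gam {V : Type*} [NormedAddCommGroup V] [NormedSpace ℝ V] (d : ℕ)
    (f : EuclideanSpace ℝ (Fin d) → V) :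
    Integrable f (gam d) ↔ Integrable (fun x => gden d ‖x‖ • f x) := by
  have hm : Measurable (fun x : EuclideanSpace ℝ (Fin d) => ENNReal.ofReal (gden d ‖x‖)) :=
    ((gden_cont d).comp continuous_norm).measurable.ennreal_ofReal
  rw [gam, integrable_withDensity_iff_integrable_smul' hm (by simp)]
  simp only [ENNReal.toReal_ofReal (gden_pos _ _).le]

lemma charFun_gam (d : ℕ) (t : EuclideanSpace ℝ (Fin d)) :
    charFun (gam d) t = Complex.exp (-(‖t‖:ℂ) ^ 2 / 2) := by
  rw [charFun_apply, integral_gam]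
  have h := GaussianFourier.integral_cexp_neg_mul_sq_norm_add (V := EuclideanSpace ℝ (Fin d))
    (b := (1/2 : ℂ)) (by norm_num) Complex.I t
  have e : ∀ x : EuclideanSpace ℝ (Fin d), gden d ‖x‖ • Complex.exp (((inner ℝ x t : ℝ) : ℂ) * Complex.I) =
      (gcst d : ℂ) * Complex.exp (-(1/2 : ℂ) * ‖x‖ ^ 2 + Complex.I * (inner ℝ t x : ℝ)) := by
    intro x
    rw [Complex.exp_add, Complex.real_smul, gden, real_inner_comm]
    push_cast
    rw [mul_comm Complex.I]
    ring
  simp only [e]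
  rw [integral_const_mul, h, gcst]
  have : ((π : ℂ) / (1/2 : ℂ)) ^ ((Module.finrank ℝ (EuclideanSpace ℝ (Fin d)) : ℂ) / 2) =
      (((2 * π) ^ ((d:ℝ) / 2) : ℝ) : ℂ) := by
    rw [Complex.ofReal_cpow (by positivity)]
    push_cast
    simp
    congr 1
    ring
  rw [this, Complex.ofReal_inv, inv_mul_cancel_left₀]
  · congr 1
    rw [Complex.I_sq]; ring
  · rw [Complex.ofReal_ne_zero]; positivity

instance (d : ℕ) : IsProbabilityMeasure (gam d) := by
  have h1 : ∫ _x, (1:ℝ) ∂(gam d) = 1 := by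
    rw [integral_gam]
    simp only [gden, smul_eq_mul, mul_one]
    rw [integral_const_mul, GaussianFourier.integral_rexp_neg_mul_sq_norm (by norm_num : (0:ℝ) < 1/2), gcst]
    rw [finrank_euclideanSpace_fin, show π / (1/2) = 2 * π by ring]
    exact inv_mul_cancel₀ (by positivity)
  constructor
  simp [Measure.real] at h1
  rwa [ENNReal.toReal_eq_one_iff] at h1

/-- bundled Gaussian -/
def gamP (d : ℕ) : ProbabilityMeasure (EuclideanSpace ℝ (Fin d)) := ⟨gam d, inferInstance⟩

lemma coe_gamP (d : ℕ) : ((gamP d : ProbabilityMeasure _) : Measure (EuclideanSpace ℝ (Fin d))) = gam d := rfl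

instance (n : ℕ) : Nontrivial (EuclideanSpace ℝ (Fin (n+1))) :=
  ⟨⟨0, EuclideanSpace.single 0 1, fun h => by
    have := congrArg (fun v => v 0) h; simp at this⟩⟩

lemma polar_vol (n : ℕ) (H : EuclideanSpace ℝ (Fin (n+1)) → ℝ) (k : ℝ → ℝ) :
    ∫ x : EuclideanSpace ℝ (Fin (n+1)), H (‖x‖⁻¹ • x) * k ‖x‖ =
      (∫ θ, H (θ : EuclideanSpace ℝ (Fin (n+1)))
        ∂((volume : Measure (EuclideanSpace ℝ (Fin (n+1)))).toSphere)) *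
      ∫ r : Set.Ioi (0:ℝ), k r ∂(Measure.volumeIoiPow (Module.finrank ℝ (EuclideanSpace ℝ (Fin (n+1))) - 1)) := by
  let μ : Measure (EuclideanSpace ℝ (Fin (n+1))) := volume
  calc
    ∫ x, H (‖x‖⁻¹ • x) * k ‖x‖ ∂μ = ∫ x : ({(0)}ᶜ : Set (EuclideanSpace ℝ (Fin (n+1)))), H (‖x.1‖⁻¹ • x.1) * k (‖x.1‖) ∂(μ.comap (↑)) := by
      rw [integral_subtype_comap (measurableSet_singleton _).compl fun x ↦ H (‖x‖⁻¹ • x) * k ‖x‖,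
        restrict_compl_singleton]
    _ = ∫ x, H x.1 * k x.2 ∂μ.toSphere.prod (.volumeIoiPow (Module.finrank ℝ (EuclideanSpace ℝ (Fin (n+1))) - 1)) := by
      simpa using μ.measurePreserving_homeomorphUnitSphereProd.integral_comp
        (Homeomorph.measurableEmbedding _) (fun x => H x.1 * k x.2)
    _ = _ := integral_prod_mul (fun θ : sphere (0 : EuclideanSpace ℝ (Fin (n+1))) 1 => H θ)
      (fun r : Set.Ioi (0:ℝ) => k r)

lemma polar_gam (n : ℕ) (H : EuclideanSpace ℝ (Fin (n+1)) → ℝ) (k : ℝ → ℝ) :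
    ∫ x, H (‖x‖⁻¹ • x) * k ‖x‖ ∂(gam (n+1)) =
      (∫ θ, H (θ : EuclideanSpace ℝ (Fin (n+1))) ∂(sphereUniform n)) *
      ∫ x, k ‖x‖ ∂(gam (n+1)) := by
  have hA := polar_vol n H (fun r => gden (n+1) r * k r)
  have hB := polar_vol n (fun _ => 1) (fun r => gden (n+1) r * k r)
  have e1 : ∫ x, H (‖x‖⁻¹ • x) * k ‖x‖ ∂(gam (n+1)) =
      ∫ x : EuclideanSpace ℝ (Fin (n+1)), H (‖x‖⁻¹ • x) * (gden (n+1) ‖x‖ * k ‖x‖) := by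
    rw [integral_gam]; congr 1; ext x; rw [smul_eq_mul]; ring
  have e2 : ∫ x, k ‖x‖ ∂(gam (n+1)) =
      ∫ x : EuclideanSpace ℝ (Fin (n+1)), 1 * (gden (n+1) ‖x‖ * k ‖x‖) := by
    rw [integral_gam]; congr 1; ext x; rw [smul_eq_mul]; ring
  rw [e1, e2, hA, hB]
  rw [sphereUniform, integral_smul_measure, integral_const]
  set u := (volume : Measure (EuclideanSpace ℝ (Fin (n+1)))).toSphere Set.univ with hu
  have hu0 : u ≠ 0 := by
    rw [hu, Ne, Measure.measure_univ_eq_zero]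
    exact Measure.toSphere_ne_zero _
  have hut : u ≠ ⊤ := measure_ne_top _ _
  have : u.toReal ≠ 0 := ENNReal.toReal_ne_zero.2 ⟨hu0, hut⟩
  rw [ENNReal.toReal_inv, Measure.real, ← hu, smul_eq_mul, smul_eq_mul]
  field_simp

instance (n : ℕ) : IsProbabilityMeasure (sphereUniform n) := by
  constructor
  rw [sphereUniform, Measure.smul_apply, smul_eq_mul]
  apply ENNReal.inv_mul_cancel
  · rw [Ne, Measure.measure_univ_eq_zero]
    exact Measure.toSphere_ne_zero _
  · exact measure_ne_top _ _

lemma radial_integrable (n : ℕ) (hn : 2 ≤ n) :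
    Integrable (fun x : EuclideanSpace ℝ (Fin (n+1)) => (‖x‖⁻¹) ^ 2) (gam (n+1)) := by
  rw [integrable_gam]
  have h := (integrable_fun_norm_addHaar (volume : Measure (EuclideanSpace ℝ (Fin (n+1))))
    (f := fun r => gden (n+1) r • (r⁻¹) ^ 2)).2
  apply h
  simp only [finrank_euclideanSpace_fin, Nat.add_sub_cancel]
  have h2 := (integrableOn_rpow_mul_exp_neg_mul_sq (b := 1/2) (by norm_num) (s := (n:ℝ) - 2)
    (by have : (2:ℝ) ≤ n := by exact_mod_cast hn
        linarith)).const_mul (gcst (n+1))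
  refine IntegrableOn.congr_fun h2 ?_ measurableSet_Ioi
  intro r (hr : 0 < r)
  simp only [gden, smul_eq_mul]
  rw [Real.rpow_sub hr, Real.rpow_natCast, Real.rpow_two]
  field_simp

lemma radial_two (n : ℕ) (hn : 2 ≤ n) :
    ∫ x : EuclideanSpace ℝ (Fin (n+1)), (‖x‖⁻¹) ^ 2 ∂(gam (n+1)) = 1 / ((n:ℝ) - 1) := by
  have hn' : (2:ℝ) ≤ n := by exact_mod_cast hn
  have h1 : ∫ x : EuclideanSpace ℝ (Fin (n+1)), (1:ℝ) ∂(gam (n+1)) = 1 := by simp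
  have A : ∀ q : ℝ → ℝ, ∫ x : EuclideanSpace ℝ (Fin (n+1)), q ‖x‖ ∂(gam (n+1)) =
      ((n+1 : ℕ) • (volume : Measure (EuclideanSpace ℝ (Fin (n+1)))).real (ball 0 1) • gcst (n+1)) *
      ∫ r in Set.Ioi (0:ℝ), r ^ n * (Real.exp (-(1/2) * r ^ 2) * q r) := by
    intro q
    rw [integral_gam]
    have := integral_fun_norm_addHaar (volume : Measure (EuclideanSpace ℝ (Fin (n+1))))
      (f := fun r => gden (n+1) r • q r)
    rw [this]
    simp only [finrank_euclideanSpace_fin, Nat.add_sub_cancel, smul_eq_mul, nsmul_eq_mul, gden]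
    have e : ∀ r : ℝ, r ^ n * (gcst (n+1) * Real.exp (-(1/2) * r ^ 2) * q r) =
      gcst (n+1) * (r ^ n * (Real.exp (-(1/2) * r ^ 2) * q r)) := fun r => by ring
    simp only [e]
    rw [integral_const_mul]
    ring
  have I1 := A (fun _ => 1)
  have I2 := A (fun r => (r⁻¹) ^ 2)
  have J1 : ∫ r in Set.Ioi (0:ℝ), r ^ n * (Real.exp (-(1/2) * r ^ 2) * 1) =
      ((1/2 : ℝ) ^ (-((n:ℝ) + 1) / 2)) * (1 / 2) * Real.Gamma (((n:ℝ) + 1) / 2) := by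
    rw [← integral_rpow_mul_exp_neg_mul_rpow (by norm_num) (by linarith) (by norm_num)]
    refine setIntegral_congr_fun measurableSet_Ioi fun r hr => ?_
    simp
  have J2 : ∫ r in Set.Ioi (0:ℝ), r ^ n * (Real.exp (-(1/2) * r ^ 2) * (r⁻¹) ^ 2) =
      ((1/2 : ℝ) ^ (-(((n:ℝ) - 2) + 1) / 2)) * (1 / 2) * Real.Gamma ((((n:ℝ) - 2) + 1) / 2) := by
    rw [← integral_rpow_mul_exp_neg_mul_rpow (by norm_num) (by linarith) (by norm_num)]
    refine setIntegral_congr_fun measurableSet_Ioi fun r (hr : 0 < r) => ?_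
    rw [Real.rpow_sub hr, Real.rpow_natCast, Real.rpow_two]
    field_simp
  rw [J1] at I1
  rw [J2] at I2
  rw [I2]
  rw [h1] at I1
  have G : Real.Gamma (((n:ℝ) + 1) / 2) = (((n:ℝ) - 1) / 2) * Real.Gamma (((n:ℝ) - 2 + 1) / 2) := by
    rw [show ((n:ℝ) + 1) / 2 = ((n:ℝ) - 1) / 2 + 1 by ring, Real.Gamma_add_one (by
      have : 0 < ((n:ℝ) - 1) / 2 := by linarith
      exact this.ne')]
    congr 2; ring
  have P : (1/2 : ℝ) ^ (-((n:ℝ) + 1) / 2) = 2 * (1/2 : ℝ) ^ (-(((n:ℝ) - 2) + 1) / 2) := by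
    rw [show -((n:ℝ) + 1) / 2 = -(((n:ℝ) - 2) + 1) / 2 + (-1) by ring, Real.rpow_add (by norm_num),
      Real.rpow_neg_one]
    ring
  rw [G, P] at I1
  have : (n:ℝ) - 1 ≠ 0 := by
    have : 0 < (n:ℝ) - 1 := by linarith
    exact this.ne'
  rw [eq_div_iff this]
  linear_combination -I1

/-- Regularized radius. -/
def rad {n : ℕ} (e : ℝ) (x : EuclideanSpace ℝ (Fin (n+1))) : ℝ := Real.sqrt (‖x‖ ^ 2 + e ^ 2)

lemma rad_pos {n : ℕ} {e : ℝ} (he : 0 < e) (x : EuclideanSpace ℝ (Fin (n+1))) : 0 < rad e x := by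
  unfold rad; positivity

lemma rad_ge {n : ℕ} (e : ℝ) (x : EuclideanSpace ℝ (Fin (n+1))) : ‖x‖ ≤ rad e x := by
  unfold rad
  apply Real.le_sqrt_of_sq_le
  nlinarith [sq_nonneg e]

lemma rad_cont {n : ℕ} (e : ℝ) : Continuous (rad e : EuclideanSpace ℝ (Fin (n+1)) → ℝ) := by
  unfold rad; fun_prop

lemma rad_inv_cont {n : ℕ} {e : ℝ} (he : 0 < e) :
    Continuous (fun x : EuclideanSpace ℝ (Fin (n+1)) => (rad e x)⁻¹) :=
  (rad_cont e).inv₀ fun x => (rad_pos he x).ne'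

lemma norm_y {n : ℕ} {e : ℝ} (he : 0 < e) (x : EuclideanSpace ℝ (Fin (n+1))) :
    ‖(rad e x)⁻¹ • x‖ ≤ 1 := by
  rw [norm_smul, norm_inv, Real.norm_of_nonneg (rad_pos he x).le,
    inv_mul_le_iff₀ (rad_pos he x), mul_one]
  exact rad_ge e x

lemma sgc_cont (n : ℕ) {g : EuclideanSpace ℝ (Fin (n+1)) → ℝ} (hg : ContDiff ℝ 1 g)
    (i : Fin (n+1)) : Continuous (fun x => sphereGradComp n g x i) := by
  have h1 : Continuous (∇ g) := by
    unfold gradient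
    exact (LinearIsometryEquiv.continuous _).comp (hg.continuous_fderiv (by norm_num))
  unfold sphereGradComp
  have h2 : Continuous (fun x => ∇ g x - ⟪∇ g x, x⟫ • x) := by fun_prop
  fun_prop

lemma reg_deriv (n : ℕ) {g : EuclideanSpace ℝ (Fin (n+1)) → ℝ} (hg : ContDiff ℝ 1 g)
    {e : ℝ} (he : 0 < e) (i : Fin (n+1)) (x : EuclideanSpace ℝ (Fin (n+1))) (t : ℝ) :
    HasDerivAt (fun t : ℝ => g ((rad e (x + t • EuclideanSpace.single i (1:ℝ)))⁻¹ •
        (x + t • EuclideanSpace.single i (1:ℝ))))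
      ((rad e (x + t • EuclideanSpace.single i (1:ℝ)))⁻¹ *
        sphereGradComp n g ((rad e (x + t • EuclideanSpace.single i (1:ℝ)))⁻¹ •
        (x + t • EuclideanSpace.single i (1:ℝ))) i) t := by
  have hu : HasDerivAt (fun t : ℝ => x + t • EuclideanSpace.single i (1:ℝ))
      (EuclideanSpace.single i (1:ℝ)) t := by
    simpa using ((hasDerivAt_id t).smul_const (EuclideanSpace.single i (1:ℝ))).const_add x
  set u := x + t • EuclideanSpace.single i (1:ℝ) with hud
  have hr := rad_pos he u
  have h1 := (hu.norm_sq.add_const (e ^ 2)).sqrt (by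
    have : 0 < ‖x + t • EuclideanSpace.single i (1:ℝ)‖ ^ 2 + e ^ 2 := by positivity
    exact this.ne')
  have h2 := (h1.inv hr.ne').smul hu
  have h3 : HasFDerivAt g (InnerProductSpace.toDual ℝ _ (∇ g ((rad e u)⁻¹ • u))) ((rad e u)⁻¹ • u) :=
    ((hg.differentiable (by norm_num)).differentiableAt).hasGradientAt.hasFDerivAt
  have h4 := h3.comp_hasDerivAt t h2
  refine h4.congr_deriv ?_
  rw [← hud]
  have hs : Real.sqrt (‖u‖ ^ 2 + e ^ 2) = rad e u := rfl
  rw [hs]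
  unfold sphereGradComp
  generalize ∇ g ((rad e u)⁻¹ • u) = v
  simp only [InnerProductSpace.toDual_apply_apply, inner_add_right, inner_smul_right,
    EuclideanSpace.inner_single_right, PiLp.sub_apply, PiLp.smul_apply, smul_eq_mul,
    Pi.inv_apply]
  rw [← hud, hs]
  simp
  field_simp
  ring

lemma sgc_bound (n : ℕ) {F : EuclideanSpace ℝ (Fin (n+1)) → ℝ} (hF : Continuous F) :
    ∃ C, 0 ≤ C ∧ ∀ x, ‖x‖ ≤ 1 → |F x| ≤ C := by
  obtain ⟨C, hC⟩ := (isCompact_closedBall (0 : EuclideanSpace ℝ (Fin (n+1))) 1).exists_bound_of_continuousOn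
    hF.continuousOn
  refine ⟨max C 0, le_max_right _ _, fun x hx => ?_⟩
  exact (hC x (by simpa using hx)).trans (le_max_left _ _)

lemma reg_unif (n : ℕ) {F : EuclideanSpace ℝ (Fin (n+1)) → ℝ} (hF : Continuous F)
    {e : ℝ} (he : 0 < e) :
    UniformContinuous (fun x => (rad e x)⁻¹ * F ((rad e x)⁻¹ • x)) := by
  obtain ⟨C, hC0, hC⟩ := sgc_bound n hF
  have hc : Continuous (fun x => (rad e x)⁻¹ * F ((rad e x)⁻¹ • x)) :=
    (rad_inv_cont he).mul (hF.comp ((rad_inv_cont he).smul continuous_id))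
  refine hc.uniformContinuous_of_tendsto_cocompact (x := 0) ?_
  have h1 : Tendsto (fun x : EuclideanSpace ℝ (Fin (n+1)) => (rad e x)⁻¹) (cocompact _) (𝓝 0) :=
    tendsto_inv_atTop_zero.comp
      (tendsto_atTop_mono (rad_ge e) (tendsto_norm_cocompact_atTop))
  have h2 := h1.mul_const C
  rw [zero_mul] at h2
  refine squeeze_zero_norm (fun x => ?_) h2
  rw [norm_mul, Real.norm_of_nonneg (inv_pos.2 (rad_pos he x)).le]
  exact mul_le_mul_of_nonneg_left (hC _ (norm_y he x)) (inv_pos.2 (rad_pos he x)).le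

lemma rad_tendsto {n : ℕ} (x : EuclideanSpace ℝ (Fin (n+1))) :
    Tendsto (fun m : ℕ => rad (1 / ((m:ℝ) + 1)) x) atTop (𝓝 ‖x‖) := by
  have h : Tendsto (fun m : ℕ => 1 / ((m:ℝ) + 1)) atTop (𝓝 0) := tendsto_one_div_add_atTop_nhds_zero_nat
  have h2 : Continuous (fun e : ℝ => rad e x) := by unfold rad; fun_prop
  have := (h2.tendsto 0).comp h
  have h0 : rad 0 x = ‖x‖ := by simp [rad]
  rw [h0] at this
  exact this

lemma rad_inv_tendsto {n : ℕ} {x : EuclideanSpace ℝ (Fin (n+1))} (hx : x ≠ 0) :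
    Tendsto (fun m : ℕ => (rad (1 / ((m:ℝ) + 1)) x)⁻¹) atTop (𝓝 ‖x‖⁻¹) :=
  (rad_tendsto x).inv₀ (norm_ne_zero_iff.2 hx)

lemma gam_ne_zero (n : ℕ) : ∀ᵐ x ∂(gam (n+1)), x ≠ (0 : EuclideanSpace ℝ (Fin (n+1))) := by
  have : gam (n+1) ≪ (volume : Measure (EuclideanSpace ℝ (Fin (n+1)))) :=
    withDensity_absolutelyContinuous _ _
  exact this.ae_le (compl_mem_ae_iff.2 (measure_singleton 0))

lemma reg_lim (n : ℕ) {F : EuclideanSpace ℝ (Fin (n+1)) → ℝ} (hF : Continuous F)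
    (p : ℕ) (hb : Integrable (fun x => (‖x‖⁻¹) ^ p) (gam (n+1))) :
    Tendsto (fun m : ℕ => ∫ x, ((rad (1 / ((m:ℝ) + 1)) x)⁻¹) ^ p *
        F ((rad (1 / ((m:ℝ) + 1)) x)⁻¹ • x) ∂(gam (n+1))) atTop
      (𝓝 (∫ x, F (‖x‖⁻¹ • x) * (‖x‖⁻¹) ^ p ∂(gam (n+1)))) := by
  obtain ⟨C, hC0, hC⟩ := sgc_bound n hF
  refine tendsto_integral_of_dominated_convergence (fun x => (‖x‖⁻¹) ^ p * C) ?_ (hb.mul_const C) ?_ ?_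
  · intro m
    have he : (0:ℝ) < 1 / ((m:ℝ) + 1) := by positivity
    exact (((rad_inv_cont he).pow p).mul
      (hF.comp ((rad_inv_cont he).smul continuous_id))).aestronglyMeasurable
  · intro m
    have he : (0:ℝ) < 1 / ((m:ℝ) + 1) := by positivity
    filter_upwards [gam_ne_zero n] with x hx
    have hx' : 0 < ‖x‖ := norm_pos_iff.2 hx
    have hp := rad_pos he x
    rw [norm_mul, norm_pow, Real.norm_of_nonneg (inv_pos.2 hp).le]
    refine mul_le_mul ?_ (hC _ (norm_y he x)) (norm_nonneg _) (by positivity)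
    exact pow_le_pow_left₀ (inv_pos.2 hp).le (inv_anti₀ hx' (rad_ge _ x)) p
  · filter_upwards [gam_ne_zero n] with x hx
    have h := rad_inv_tendsto hx
    have h2 := (hF.tendsto _).comp (h.smul_const x)
    rw [mul_comm]
    exact (h.pow p).mul h2

lemma radial_one_int (n : ℕ) (hn : 2 ≤ n) :
    Integrable (fun x : EuclideanSpace ℝ (Fin (n+1)) => (‖x‖⁻¹) ^ 1) (gam (n+1)) := by
  refine ((integrable_const (1:ℝ)).add (radial_integrable n hn)).mono' ?_ ?_
  · exact (measurable_norm.inv.pow_const 1).aestronglyMeasurable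
  · refine Eventually.of_forall fun x => ?_
    simp only [pow_one, Pi.add_apply]
    rw [Real.norm_of_nonneg (by positivity)]
    nlinarith [sq_nonneg (‖x‖⁻¹ - 1)]

lemma radial_one_le (n : ℕ) (hn : 2 ≤ n) :
    ∫ x : EuclideanSpace ℝ (Fin (n+1)), (‖x‖⁻¹) ^ 1 ∂(gam (n+1)) ≤ Real.sqrt (1 / ((n:ℝ) - 1)) := by
  apply Real.le_sqrt_of_sq_le
  rw [← radial_two n hn]
  set M := ∫ x : EuclideanSpace ℝ (Fin (n+1)), (‖x‖⁻¹) ^ 1 ∂(gam (n+1)) with hM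
  have h : 0 ≤ ∫ x : EuclideanSpace ℝ (Fin (n+1)), ((‖x‖⁻¹) ^ 1 - M) ^ 2 ∂(gam (n+1)) :=
    integral_nonneg fun x => sq_nonneg _
  have e : ∀ x : EuclideanSpace ℝ (Fin (n+1)), ((‖x‖⁻¹) ^ 1 - M) ^ 2 =
      (‖x‖⁻¹) ^ 2 - 2 * M * (‖x‖⁻¹) ^ 1 + M ^ 2 := fun x => by ring
  simp only [e] at h
  have hs : Integrable (fun x : EuclideanSpace ℝ (Fin (n+1)) => (‖x‖⁻¹) ^ 2 - 2 * M * (‖x‖⁻¹) ^ 1)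
    (gam (n+1)) := (radial_integrable n hn).sub ((radial_one_int n hn).const_mul _)
  rw [integral_add hs (integrable_const _), integral_sub (radial_integrable n hn) ((radial_one_int n hn).const_mul _),
    integral_const_mul, ← hM] at h
  simp only [integral_const, probReal_univ, smul_eq_mul, one_mul] at h
  nlinarith

lemma polar_pow (n : ℕ) (H : EuclideanSpace ℝ (Fin (n+1)) → ℝ) (p : ℕ) :
    ∫ x, H (‖x‖⁻¹ • x) * (‖x‖⁻¹) ^ p ∂(gam (n+1)) =
      (∫ θ, H (θ : EuclideanSpace ℝ (Fin (n+1))) ∂(sphereUniform n)) *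
      ∫ x : EuclideanSpace ℝ (Fin (n+1)), (‖x‖⁻¹) ^ p ∂(gam (n+1)) :=
  polar_gam n H (fun r => (r⁻¹) ^ p)

lemma sphere_ineq (n : ℕ) (hn : 2 ≤ n) {g : EuclideanSpace ℝ (Fin (n+1)) → ℝ} (hg : ContDiff ℝ 1 g)
    {α β : Fin (n+1) → ℝ}
    (hα : ∀ i, Real.sqrt (1 / ((n:ℝ) - 1)) *
      ∫ θ, |sphereGradComp n g θ i| ∂(sphereUniform n) < α i)
    (hβ : ∀ i, (1 / ((n:ℝ) - 1)) * ∫ θ, (sphereGradComp n g θ i) ^ 2 ∂(sphereUniform n) < β i) :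
    ∫ θ : sphere (0 : EuclideanSpace ℝ (Fin (n+1))) 1, (g θ) ^ 2 ∂(sphereUniform n) -
      (∫ θ : sphere (0 : EuclideanSpace ℝ (Fin (n+1))) 1, g θ ∂(sphereUniform n)) ^ 2 ≤
      ∑ i, ∫ s in (0:ℝ)..1, psi (α i) (β i) s := by
  have hi0 : Integrable (fun x : EuclideanSpace ℝ (Fin (n+1)) => (‖x‖⁻¹) ^ 0) (gam (n+1)) := by
    simp
  have L1 := reg_lim n hg.continuous 0 hi0
  have L2 := reg_lim n (F := fun x => g x ^ 2) (hg.continuous.pow 2) 0 hi0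
  have L3 := fun i => reg_lim n (sgc_cont n hg i).abs 1 (radial_one_int n hn)
  have L4 := fun i => reg_lim n (F := fun x => (sphereGradComp n g x i) ^ 2) ((sgc_cont n hg i).pow 2) 2 (radial_integrable n hn)
  rw [polar_pow n g 0] at L1
  rw [polar_pow n (fun x => g x ^ 2) 0] at L2
  have e3 := fun i => polar_pow n (fun x => |sphereGradComp n g x i|) 1
  have e4 := fun i => polar_pow n (fun x => (sphereGradComp n g x i) ^ 2) 2
  simp only [e3] at L3
  simp only [e4, radial_two n hn] at L4
  have m3 : ∀ i, ∀ᶠ m : ℕ in atTop, ∫ x, ((rad (1 / ((m:ℝ) + 1)) x)⁻¹) ^ 1 *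
        |sphereGradComp n g ((rad (1 / ((m:ℝ) + 1)) x)⁻¹ • x) i| ∂(gam (n+1)) < α i := by
    intro i
    refine (L3 i).eventually_lt_const (lt_of_le_of_lt ?_ (hα i))
    rw [mul_comm]
    exact mul_le_mul_of_nonneg_right (radial_one_le n hn) (integral_nonneg fun _ => abs_nonneg _)
  have m4 : ∀ i, ∀ᶠ m : ℕ in atTop, ∫ x, ((rad (1 / ((m:ℝ) + 1)) x)⁻¹) ^ 2 *
        (sphereGradComp n g ((rad (1 / ((m:ℝ) + 1)) x)⁻¹ • x) i) ^ 2 ∂(gam (n+1)) < β i := by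
    intro i
    refine (L4 i).eventually_lt_const (lt_of_le_of_lt (le_of_eq (mul_comm _ _)) (hβ i))
  simp only [pow_zero, one_mul, integral_const, probReal_univ, smul_eq_mul, mul_one] at L1 L2
  refine le_of_tendsto (L2.sub (L1.pow 2)) ?_
  filter_upwards [eventually_all.2 m3, eventually_all.2 m4] with m h3 h4
  have he : (0:ℝ) < 1 / ((m:ℝ) + 1) := by positivity
  generalize (1 / ((m:ℝ) + 1)) = e at *
  obtain ⟨C, hC0, hC⟩ := sgc_bound n hg.continuous
  choose D hD0 hD using fun i => sgc_bound n (sgc_cont n hg i)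
  have := gauss_ineq (gamP (n+1)) (by intro t; rw [coe_gamP]; exact charFun_gam _ t)
    (fun x => g ((rad e x)⁻¹ • x)) (fun i x => (rad e x)⁻¹ * sphereGradComp n g ((rad e x)⁻¹ • x) i)
    (fun i x t => reg_deriv n hg he i x t)
    (hg.continuous.comp ((rad_inv_cont he).smul continuous_id))
    (fun x => hC _ (norm_y he x))
    (fun i => reg_unif n (sgc_cont n hg i) he)
    (C' := e⁻¹ * ∑ i, D i)
    (fun i x => by
      have hp := rad_pos he x
      rw [abs_mul, abs_of_pos (inv_pos.2 hp)]
      refine mul_le_mul ?_ ((hD i _ (norm_y he x)).trans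
        (Finset.single_le_sum (fun j _ => hD0 j) (Finset.mem_univ i))) (abs_nonneg _) (by positivity)
      refine inv_anti₀ he ?_
      unfold rad
      apply Real.le_sqrt_of_sq_le
      nlinarith [sq_nonneg ‖x‖])
    (α := α) (β := β)
    (fun i => by
      rw [coe_gamP]
      refine lt_of_eq_of_lt (integral_congr_ae (Eventually.of_forall fun x => ?_)) (h3 i)
      simp only [pow_one]
      rw [abs_mul, abs_of_pos (inv_pos.2 (rad_pos he x))])
    (fun i => by
      rw [coe_gamP]
      refine lt_of_eq_of_lt (integral_congr_ae (Eventually.of_forall fun x => ?_)) (h4 i)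
      simp only [mul_pow])
  rw [coe_gamP] at this
  exact this

lemma psi_lim {A B : ℝ} (hA : 0 ≤ A) (hB : 0 ≤ B) :
    Tendsto (fun m : ℕ => ∫ s in (0:ℝ)..1, psi (A + 1 / ((m:ℝ) + 1)) (B + 1 / ((m:ℝ) + 1)) s) atTop
      (𝓝 (∫ s in (0:ℝ)..1, psi A B s)) := by
  have hd : Tendsto (fun m : ℕ => 1 / ((m:ℝ) + 1)) atTop (𝓝 0) :=
    tendsto_one_div_add_atTop_nhds_zero_nat
  have hne : ∀ᵐ s : ℝ, s ≠ 1 := compl_mem_ae_iff.2 (measure_singleton 1)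
  refine intervalIntegral.tendsto_integral_filter_of_dominated_convergence
    (fun s => psi (A + 1) (B + 1) s) ?_ ?_ (psi_intervalIntegrable (by linarith) (by linarith)) ?_
  · refine Eventually.of_forall fun m => ?_
    have he : (0:ℝ) < 1 / ((m:ℝ) + 1) := by positivity
    exact (psi_intervalIntegrable (by linarith) (by linarith)).aestronglyMeasurable_restrict_uIoc
  · refine Eventually.of_forall fun m => ?_
    have he : (0:ℝ) < 1 / ((m:ℝ) + 1) := by positivity
    have he1 : 1 / ((m:ℝ) + 1) ≤ 1 := by
      rw [div_le_one (by positivity)]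
      have : (0:ℝ) ≤ m := by positivity
      linarith
    filter_upwards [hne] with s hs hs'
    rw [uIoc_of_le zero_le_one] at hs'
    rw [Real.norm_of_nonneg (by unfold psi; positivity)]
    exact psi_mono hs'.1 (lt_of_le_of_ne hs'.2 hs) (by linarith) (by linarith) (by linarith) (by linarith)
  · filter_upwards [hne] with s hs hs'
    rw [uIoc_of_le zero_le_one] at hs'
    have h0 := hs'.1
    have h1 := lt_of_le_of_ne hs'.2 hs
    have hA1 : Tendsto (fun m : ℕ => A + 1 / ((m:ℝ) + 1)) atTop (𝓝 A) := by
      simpa using hd.const_add A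
    have hB1 : Tendsto (fun m : ℕ => B + 1 / ((m:ℝ) + 1)) atTop (𝓝 B) := by
      simpa using hd.const_add B
    unfold psi
    refine (hA1.rpow_const (Or.inr ?_)).mul (hB1.rpow_const (Or.inr ?_))
    · have : 0 < 1 - s := by linarith
      positivity
    · positivity

lemma psi_phi {A B : ℝ} (hA : 0 ≤ A) (hB : 0 ≤ B) (hAB : A = 0 → B = 0) :
    ∫ s in (0:ℝ)..1, psi A B s = B * phiBKS (A / Real.sqrt B) := by
  rcases hB.eq_or_lt with h | hB'
  · rw [← h, zero_mul]
    rw [intervalIntegral.integral_of_le zero_le_one]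
    have : ∫ s in Set.Ioc (0:ℝ) 1, psi A 0 s = ∫ s in Set.Ioc (0:ℝ) 1, (0:ℝ) := by
      refine setIntegral_congr_fun measurableSet_Ioc fun s hs => ?_
      have : 2 * s / (1 + s) ≠ 0 := by
        have := hs.1
        positivity
      simp only [psi]
      rw [Real.zero_rpow this, mul_zero]
    rw [this]; simp
  have hA' : 0 < A := lt_of_le_of_ne hA fun h => hB'.ne' (hAB h.symm)
  have hq : 0 < A / Real.sqrt B := by positivity
  set u := A / Real.sqrt B with hu
  have key : ∀ s : ℝ, 0 ≤ s → psi A B s = B * u ^ (2 * ((1 - s) / (1 + s))) := by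
    intro s hs
    have hA2 : A = u * B ^ (1/2 : ℝ) := by
      rw [hu, ← Real.sqrt_eq_rpow]; field_simp
    unfold psi
    rw [show A ^ (2 * (1 - s) / (1 + s)) = (u * B ^ (1/2 : ℝ)) ^ (2 * (1 - s) / (1 + s)) by rw [← hA2]]
    rw [Real.mul_rpow hq.le (by positivity), ← Real.rpow_mul hB, mul_assoc, ← Real.rpow_add hB',
      show 1 / 2 * (2 * (1 - s) / (1 + s)) + 2 * s / (1 + s) = 1 by field_simp; ring,
      Real.rpow_one, mul_comm, mul_div_assoc]
  have e1 : ∫ s in (0:ℝ)..1, psi A B s = ∫ s in (0:ℝ)..1, B * u ^ (2 * ((1 - s) / (1 + s))) := by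
    refine intervalIntegral.integral_congr fun s hs => ?_
    rw [uIcc_of_le zero_le_one] at hs
    exact key s hs.1
  rw [e1, intervalIntegral.integral_const_mul]
  congr 1
  have hder : ∀ t ∈ uIcc (0:ℝ) 1, HasDerivAt (fun t : ℝ => (1 - t) / (1 + t)) (-2 / (1 + t) ^ 2) t := by
    intro t ht
    rw [uIcc_of_le zero_le_one] at ht
    have h0 : (1 + t) ≠ 0 := by have := ht.1; positivity
    have := ((hasDerivAt_id t).const_sub 1).div ((hasDerivAt_id t).const_add 1) h0
    refine this.congr_deriv ?_
    simp only [id]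
    congr 1
    ring
  have hcd : ContinuousOn (fun t : ℝ => -2 / (1 + t) ^ 2) (uIcc (0:ℝ) 1) := by
    rw [uIcc_of_le zero_le_one]
    refine continuousOn_const.div (by fun_prop) fun t ht => ?_
    have := ht.1
    positivity
  have hG : ContinuousOn (fun s : ℝ => u ^ (2 * ((1 - s) / (1 + s))))
      ((fun t : ℝ => (1 - t) / (1 + t)) '' uIcc (0:ℝ) 1) := by
    have hm : ∀ s ∈ (fun t : ℝ => (1 - t) / (1 + t)) '' uIcc (0:ℝ) 1, 0 ≤ s := by
      rintro s ⟨t, ht, rfl⟩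
      rw [uIcc_of_le zero_le_one] at ht
      have h1 : 0 ≤ 1 - t := by linarith [ht.2]
      have := ht.1
      positivity
    refine ContinuousOn.rpow continuousOn_const ?_ fun _ _ => Or.inl hq.ne'
    refine continuousOn_const.mul (ContinuousOn.div (by fun_prop) (by fun_prop) fun s hs => ?_)
    have := hm s hs
    positivity
  have := intervalIntegral.integral_comp_mul_deriv' hder hcd hG
  simp only [show ((1:ℝ) - 0) / (1 + 0) = 1 by norm_num, show ((1:ℝ) - 1) / (1 + 1) = 0 by norm_num] at this
  rw [intervalIntegral.integral_symm 0 1] at this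
  have h5 := neg_eq_iff_eq_neg.2 this
  unfold phiBKS
  rw [← intervalIntegral.integral_const_mul, ← h5, ← intervalIntegral.integral_neg]
  refine intervalIntegral.integral_congr fun t ht => ?_
  rw [uIcc_of_le zero_le_one] at ht
  have ht0 := ht.1
  have h3 : (1 - (1 - t) / (1 + t)) / (1 + (1 - t) / (1 + t)) = t := by
    field_simp
    ring
  simp only [Function.comp, h3]
  ring

lemma msphere (n : ℕ) (hn : 2 ≤ n)
    (g : EuclideanSpace ℝ (Fin (n+1)) → ℝ)
    (hg : ContDiff ℝ 1 g) :
    variance (fun θ : sphere (0 : EuclideanSpace ℝ (Fin (n+1))) 1 => g θ)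
        (sphereUniform n) ≤
      (1/((n : ℝ) - 1)) *
        ∑ i : Fin (n+1),
          (∫ θ, (sphereGradComp n g θ i)^2 ∂(sphereUniform n)) *
            phiBKS ((∫ θ, |sphereGradComp n g θ i| ∂(sphereUniform n)) /
              Real.sqrt (∫ θ, (sphereGradComp n g θ i)^2 ∂(sphereUniform n))) := by
  have hc : 0 < 1 / ((n:ℝ) - 1) := by
    have : (2:ℝ) ≤ n := by exact_mod_cast hn
    have : 0 < (n:ℝ) - 1 := by linarith
    positivity
  obtain ⟨C, hC0, hC⟩ := sgc_bound n hg.continuous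
  have hmem : MemLp (fun θ : sphere (0 : EuclideanSpace ℝ (Fin (n+1))) 1 => g θ) 2
      (sphereUniform n) := by
    refine MemLp.of_bound (hg.continuous.comp continuous_subtype_val).aestronglyMeasurable C
      (Eventually.of_forall fun θ => hC _ ?_)
    have := θ.2
    simp only [mem_sphere_iff_norm, sub_zero] at this
    exact this.le
  rw [variance_eq_sub hmem]
  simp only [Pi.pow_apply]
  have hA0 : ∀ i, 0 ≤ ∫ θ, |sphereGradComp n g θ i| ∂(sphereUniform n) :=
    fun i => integral_nonneg fun _ => abs_nonneg _
  have hB0 : ∀ i, 0 ≤ ∫ θ, (sphereGradComp n g θ i) ^ 2 ∂(sphereUniform n) :=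
    fun i => integral_nonneg fun _ => sq_nonneg _
  have hAB : ∀ i, ∫ θ, |sphereGradComp n g θ i| ∂(sphereUniform n) = 0 →
      ∫ θ, (sphereGradComp n g θ i) ^ 2 ∂(sphereUniform n) = 0 := by
    intro i h
    obtain ⟨D, hD0, hD⟩ := sgc_bound n (sgc_cont n hg i)
    have hint : Integrable (fun θ : sphere (0 : EuclideanSpace ℝ (Fin (n+1))) 1 =>
        |sphereGradComp n g θ i|) (sphereUniform n) := by
      refine Integrable.abs (Integrable.of_bound
        ((sgc_cont n hg i).comp continuous_subtype_val).aestronglyMeasurable D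
        (Eventually.of_forall fun θ => hD _ ?_))
      have := θ.2
      simp only [mem_sphere_iff_norm, sub_zero] at this
      exact this.le
    rw [integral_eq_zero_iff_of_nonneg (fun _ => abs_nonneg _) hint] at h
    refine integral_eq_zero_of_ae ?_
    filter_upwards [h] with θ hθ
    have : sphereGradComp n g θ i = 0 := abs_eq_zero.1 hθ
    simp [this]
  have main := le_of_tendsto_of_tendsto' (tendsto_const_nhds (x :=
      ∫ θ : sphere (0 : EuclideanSpace ℝ (Fin (n+1))) 1, (g θ) ^ 2 ∂(sphereUniform n) -
      (∫ θ : sphere (0 : EuclideanSpace ℝ (Fin (n+1))) 1, g θ ∂(sphereUniform n)) ^ 2))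
    (tendsto_finsetSum Finset.univ fun i _ => psi_lim
      (mul_nonneg (Real.sqrt_nonneg (1 / ((n:ℝ) - 1))) (hA0 i)) (mul_nonneg hc.le (hB0 i)))
    (fun m => by
      have he : (0:ℝ) < 1 / ((m:ℝ) + 1) := by positivity
      exact sphere_ineq n hn hg (fun i => by linarith) (fun i => by linarith))
  refine main.trans (le_of_eq ?_)
  rw [Finset.mul_sum]
  refine Finset.sum_congr rfl fun i _ => ?_
  rw [← psi_phi (hA0 i) (hB0 i) (hAB i), ← intervalIntegral.integral_const_mul]
  refine intervalIntegral.integral_congr fun s hs => ?_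
  rw [uIcc_of_le zero_le_one] at hs
  have h := psi_scale (hA0 i) (hB0 i) (Real.sqrt_pos.2 hc) hs.1
  rw [Real.sq_sqrt hc.le] at h
  exact h

/-- **Corollary 3.3 of Benaïm–Rossignol (uniform distribution on `S^n`).**
For `n ≥ 2` and `g` a (continuously differentiable, hence Sobolev) function on `S^n`,
with `∇_i g(θ)` the `i`-th component in `ℝ^{n+1}` of the Riemannian gradient of `g` at `θ`,
`Var(g) ≤ (1/(n-1)) Σ_{i=1}^{n+1} ‖∇_i g‖₂² φ(‖∇_i g‖₁/‖∇_i g‖₂)`,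
norms and variance being taken with respect to the normalized uniform measure `dv_n`. -/
theorem modified_poincare_sphere
    (n : ℕ) (hn : 2 ≤ n)
    (g : EuclideanSpace ℝ (Fin (n+1)) → ℝ)
    (hg : ContDiff ℝ 1 g) :
    variance (fun θ : sphere (0 : EuclideanSpace ℝ (Fin (n+1))) 1 => g θ)
        (sphereUniform n) ≤
      (1/((n : ℝ) - 1)) *
        ∑ i : Fin (n+1),
          (∫ θ, (sphereGradComp n g θ i)^2 ∂(sphereUniform n)) *
            phiBKS ((∫ θ, |sphereGradComp n g θ i| ∂(sphereUniform n)) /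
              Real.sqrt (∫ θ, (sphereGradComp n g θ i)^2 ∂(sphereUniform n))) := by
  exact msphere n hn g hg

end
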